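/- Let d = 3. There exists ε > 0 such that for every potential V : ℤ³ → ℂ with ‖V‖_{ℓ^{7/6}(ℤ³)} ≤ ε, every λ ∈ ℂ and every ψ ∈ ℓ²(ℤ³) satisfying the stationary discrete Klein–Gordon eigenvalue equation √(1−Δ)ψ + Vψ = λψ, one has ψ = 0. -/

import Mathlib

open MeasureTheory Real
open scoped ENNReal

noncomputable section

/-- Dispersion relation of the discrete Klein--Gordon equation on `ℤ^d`. -/
def omegaKG (d : ℕ) (ξ : Fin d → ℝ) : ℝ :=
  Real.sqrt (1 + ∑ j : Fin d, 2 * (1 - Real.cos (ξ j)))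

/-- The fundamental domain `[0, 2π]^d` of the torus. -/
def cube (d : ℕ) : Set (Fin d → ℝ) := Set.Icc 0 (fun _ => 2 * Real.pi)

/-- The convolution kernel of the Fourier multiplier on `ℤ^d` with symbol `m(ξ)`. -/
def multKernel (d : ℕ) (m : (Fin d → ℝ) → ℝ) (x : Fin d → ℤ) : ℂ :=
  ((((2 * Real.pi) ^ d)⁻¹ : ℝ) : ℂ) *
    ∫ ξ in cube d,
      Complex.exp (Complex.I * ((∑ j : Fin d, (x j : ℝ) * ξ j : ℝ) : ℂ)) * ((m ξ : ℝ) : ℂ)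

/-- The propagator `cos(t√(1−Δ))`, realized as the Fourier multiplier with symbol
`cos(t ω(ξ))`. -/
def cosProp (d : ℕ) (t : ℝ) (f : (Fin d → ℤ) → ℂ) (x : Fin d → ℤ) : ℂ :=
  ∑' y : Fin d → ℤ, multKernel d (fun ξ => Real.cos (t * omegaKG d ξ)) (x - y) * f y

/-- The propagator `sin(t√(1−Δ))/√(1−Δ)`, realized as the Fourier multiplier with symbol
`sin(t ω(ξ))/ω(ξ)`. -/
def sinProp (d : ℕ) (t : ℝ) (f : (Fin d → ℤ) → ℂ) (x : Fin d → ℤ) : ℂ :=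
  ∑' y : Fin d → ℤ, multKernel d (fun ξ => Real.sin (t * omegaKG d ξ) / omegaKG d ξ) (x - y) * f y

/-- The operator `√(1−Δ)`, realized as the Fourier multiplier with symbol `ω(ξ)`. -/
def sqrtOneSubLap (d : ℕ) (f : (Fin d → ℤ) → ℂ) (x : Fin d → ℤ) : ℂ :=
  ∑' y : Fin d → ℤ, multKernel d (omegaKG d) (x - y) * f y

/-- The solution of the inhomogeneous discrete Klein--Gordon equation with data `(f,g)`
and forcing term `F`, given by Duhamel's formula. -/
def duhamel (d : ℕ) (t : ℝ) (f g : (Fin d → ℤ) → ℂ) (F : ℝ → (Fin d → ℤ) → ℂ)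
    (x : Fin d → ℤ) : ℂ :=
  cosProp d t f x + sinProp d t g x + ∫ s in (0:ℝ)..t, sinProp d (t - s) (F s) x

/-- The `L^q` norm in time of an `ℝ≥0∞`-valued function. -/
def lqNorm (q : ℝ≥0∞) (g : ℝ → ℝ≥0∞) : ℝ≥0∞ :=
  if q = ∞ then essSup g volume else (∫⁻ t, g t ^ q.toReal) ^ (1 / q.toReal)

/-- The mixed space-time norm `‖F‖_{L^q_t ℓ^r_x}`. -/
def mixedNorm (d : ℕ) (q r : ℝ≥0∞) (F : ℝ → (Fin d → ℤ) → ℂ) : ℝ≥0∞ :=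
  lqNorm q fun t => eLpNorm (F t) r Measure.count

section OscillatoryIntegral

/-- First derivative test for the phase `u ↦ t sin u - a u` on a subinterval of `[0, π]`. -/
lemma norm_integral_phase_le_of_deriv {t a p q ρ : ℝ} (ht : 0 ≤ t) (hp : 0 ≤ p) (hpq : p ≤ q)
    (hq : q ≤ π) (hρ : 0 < ρ)
    (h : (∀ u ∈ Set.Icc p q, ρ ≤ t * Real.cos u - a) ∨
      (∀ u ∈ Set.Icc p q, t * Real.cos u - a ≤ -ρ)) :
    ‖∫ u in p..q, Complex.exp (Complex.I * ((t * Real.sin u - a * u : ℝ) : ℂ))‖ ≤ 3 / ρ := by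
  set g : ℝ → ℝ := fun u => t * Real.cos u - a with hg
  have hg0 : ∀ u ∈ Set.Icc p q, g u ≠ 0 := by
    intro u hu
    rcases h with h | h <;> have := h u hu <;> simp only [hg] <;> intro h0 <;> linarith
  have hgd : ∀ u, HasDerivAt g (-(t * Real.sin u)) u := fun u => by
    exact (((Real.hasDerivAt_cos u).const_mul t).sub_const a).congr_deriv (by ring)
  have hgc : Continuous g := by fun_prop
  have hφd : ∀ u, HasDerivAt (fun u : ℝ => t * Real.sin u - a * u) (g u) u := fun u => by
    simpa [hg] using ((Real.hasDerivAt_sin u).const_mul t).fun_sub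
      ((hasDerivAt_id u).const_mul a)
  have huIcc : Set.uIcc p q = Set.Icc p q := Set.uIcc_of_le hpq
  have hinv : ∀ u ∈ Set.Icc p q, HasDerivAt (fun u => (g u)⁻¹) (t * Real.sin u / g u ^ 2) u := by
    intro u hu
    simpa using (hgd u).fun_inv (hg0 u hu)
  have hcont : ContinuousOn (fun u => t * Real.sin u / g u ^ 2) (Set.Icc p q) := by
    apply ContinuousOn.div
    · fun_prop
    · fun_prop
    · exact fun u hu => pow_ne_zero 2 (hg0 u hu)
  have hinv' : ∀ u ∈ Set.uIcc p q, HasDerivAt (fun u : ℝ => (((g u)⁻¹ : ℝ) : ℂ))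
      ((t * Real.sin u / g u ^ 2 : ℝ) : ℂ) u := by
    intro u hu
    rw [huIcc] at hu
    exact (hinv u hu).ofReal_comp
  have hexp : ∀ u ∈ Set.uIcc p q,
      HasDerivAt (fun u : ℝ => -Complex.I *
        Complex.exp (Complex.I * ((t * Real.sin u - a * u : ℝ) : ℂ)))
        ((g u : ℂ) * Complex.exp (Complex.I * ((t * Real.sin u - a * u : ℝ) : ℂ))) u := by
    intro u _
    refine ((((hφd u).ofReal_comp).const_mul Complex.I).cexp.const_mul
      (-Complex.I)).congr_deriv ?_
    linear_combination (-(g u : ℂ) * Complex.exp (Complex.I * ((t * Real.sin u - a * u : ℝ) : ℂ))) *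
      Complex.I_mul_I
  have hi1 : IntervalIntegrable (fun u : ℝ => ((t * Real.sin u / g u ^ 2 : ℝ) : ℂ)) volume p q := by
    apply ContinuousOn.intervalIntegrable
    rw [huIcc]
    exact Complex.continuous_ofReal.comp_continuousOn hcont
  have hi2 : IntervalIntegrable (fun u : ℝ => (g u : ℂ) *
      Complex.exp (Complex.I * ((t * Real.sin u - a * u : ℝ) : ℂ))) volume p q := by
    apply Continuous.intervalIntegrable
    fun_prop
  have key := intervalIntegral.integral_mul_deriv_eq_deriv_mul hinv' hexp hi1 hi2
  have hlhs : (∫ u in p..q, (((g u)⁻¹ : ℝ) : ℂ) * ((g u : ℂ) *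
      Complex.exp (Complex.I * ((t * Real.sin u - a * u : ℝ) : ℂ)))) =
      ∫ u in p..q, Complex.exp (Complex.I * ((t * Real.sin u - a * u : ℝ) : ℂ)) := by
    apply intervalIntegral.integral_congr
    intro u hu
    rw [huIcc] at hu
    have : (g u : ℂ) ≠ 0 := by exact_mod_cast hg0 u hu
    simp only [Complex.ofReal_inv]
    field_simp
  rw [hlhs] at key
  rw [key]
  have hnorm : ∀ u : ℝ, ‖-Complex.I *
      Complex.exp (Complex.I * ((t * Real.sin u - a * u : ℝ) : ℂ))‖ = 1 := by
    intro u
    rw [norm_mul, Complex.norm_exp_I_mul_ofReal]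
    simp
  have hb : ∀ u ∈ Set.Icc p q, |(g u)⁻¹| ≤ 1 / ρ := by
    intro u hu
    rw [abs_inv, ← one_div]
    apply one_div_le_one_div_of_le hρ
    rcases h with h | h
    · exact (h u hu).trans (le_abs_self _)
    · exact (le_neg_of_le_neg (h u hu)).trans (neg_le_abs _)
  have hint : ‖∫ u in p..q, ((t * Real.sin u / g u ^ 2 : ℝ) : ℂ) * (-Complex.I *
      Complex.exp (Complex.I * ((t * Real.sin u - a * u : ℝ) : ℂ)))‖ ≤ (g q)⁻¹ - (g p)⁻¹ := by
    have h1 : ∫ u in p..q, t * Real.sin u / g u ^ 2 = (g q)⁻¹ - (g p)⁻¹ := by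
      apply intervalIntegral.integral_eq_sub_of_hasDerivAt
      · intro u hu; rw [huIcc] at hu; exact hinv u hu
      · apply ContinuousOn.intervalIntegrable
        rwa [huIcc]
    rw [← h1]
    apply intervalIntegral.norm_integral_le_of_norm_le hpq
    · refine Filter.Eventually.of_forall fun u hu => ?_
      rw [norm_mul, hnorm, mul_one, Complex.norm_real, Real.norm_eq_abs, abs_of_nonneg]
      have := Real.sin_nonneg_of_nonneg_of_le_pi (hp.trans hu.1.le) (hu.2.trans hq)
      positivity
    · apply ContinuousOn.intervalIntegrable
      rwa [huIcc]
  have hpm : p ∈ Set.Icc p q := ⟨le_rfl, hpq⟩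
  have hqm : q ∈ Set.Icc p q := ⟨hpq, le_rfl⟩
  have hdiff : (g q)⁻¹ - (g p)⁻¹ ≤ 1 / ρ := by
    have h1 := hb p hpm
    have h2 := hb q hqm
    rw [abs_le] at h1 h2
    rcases h with h | h
    · have : 0 < (g p)⁻¹ := inv_pos.mpr (hρ.trans_le (h p hpm))
      linarith
    · have : (g q)⁻¹ < 0 := inv_lt_zero.mpr (by have := h q hqm; simp only [hg]; linarith)
      linarith
  refine (norm_sub_le _ _).trans ?_
  have h3 : ∀ u ∈ Set.Icc p q, ‖(((g u)⁻¹ : ℝ) : ℂ) * (-Complex.I *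
      Complex.exp (Complex.I * ((t * Real.sin u - a * u : ℝ) : ℂ)))‖ ≤ 1 / ρ := by
    intro u hu
    rw [norm_mul, hnorm, mul_one, Complex.norm_real]
    exact hb u hu
  have h4 := (norm_sub_le _ _).trans (add_le_add (h3 q hqm) (h3 p hpm))
  have h5 : 3 / ρ = 1 / ρ + 1 / ρ + 1 / ρ := by ring
  rw [h5]
  exact add_le_add h4 (hint.trans hdiff)

/-- The set where the derivative of the phase has modulus at most `r` is short. -/
lemma level_set_length_le {t a r u v : ℝ} (ht : 0 < t) (hr : 4 ≤ r)
    (hD : r ^ 4 = |t ^ 2 - a ^ 2|) (hu : 0 ≤ u) (huv : u < v) (hv : v ≤ π)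
    (h1 : t * Real.cos u ≤ a + r) (h2 : a - r ≤ t * Real.cos v) : v - u ≤ 9 / r := by
  have hr0 : 0 < r := by linarith
  set m := (u + v) / 2 with hm
  set L := v - u with hL
  have hL0 : 0 < L := sub_pos.mpr huv
  have hpi := Real.pi_pos
  have hpi4 := Real.pi_le_four
  have hpi32 := Real.pi_lt_d2
  have hsinL : L / π ≤ Real.sin (L / 2) := by
    have := Real.mul_le_sin (x := L / 2) (by linarith) (by linarith)
    calc L / π = 2 / π * (L / 2) := by field_simp
      _ ≤ _ := this
  have hsinm0 : 0 ≤ Real.sin m := Real.sin_nonneg_of_nonneg_of_le_pi (by linarith) (by linarith)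
  have hsinm : L / π ≤ Real.sin m := by
    refine hsinL.trans ?_
    rcases le_total m (π / 2) with hmp | hmp
    · exact Real.sin_le_sin_of_le_of_le_pi_div_two (by linarith) hmp (by linarith)
    · rw [← Real.sin_pi_sub m]
      exact Real.sin_le_sin_of_le_of_le_pi_div_two (by linarith) (by linarith) (by linarith)
  have hcos : Real.cos u - Real.cos v = 2 * Real.sin m * Real.sin (L / 2) := by
    rw [Real.cos_sub_cos, hm, hL, show (u - v) / 2 = -((v - u) / 2) by ring, Real.sin_neg]
    ring
  have hmain : t * L * Real.sin m ≤ π * r := by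
    have h3 : t * (2 * Real.sin m * Real.sin (L / 2)) ≤ 2 * r := by
      rw [← hcos]; linarith
    have h4 : t * (2 * Real.sin m * (L / π)) ≤ 2 * r := by
      refine le_trans ?_ h3
      gcongr
    have h5 : t * (2 * Real.sin m * (L / π)) = 2 * (t * L * Real.sin m) / π := by
      field_simp
    rw [h5, div_le_iff₀ hpi] at h4
    linarith
  have hc1 : t * Real.cos m ≤ a + r := by
    refine le_trans ?_ h1
    gcongr
    exact Real.cos_le_cos_of_nonneg_of_le_pi hu (by linarith) (by linarith)
  have hc2 : a - r ≤ t * Real.cos m := by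
    refine h2.trans ?_
    gcongr
    exact Real.cos_le_cos_of_nonneg_of_le_pi (by linarith) hv (by linarith)
  have hsc := Real.sin_sq_add_cos_sq m
  set c := Real.cos m
  set s := Real.sin m
  rw [le_div_iff₀ hr0]
  by_cases hcase : r ^ 4 / 2 ≤ t ^ 2 * s ^ 2
  · have h6 : r ^ 2 / 2 ≤ t * s := by
      apply le_of_sq_le_sq _ (by positivity)
      nlinarith [sq_nonneg (r^2)]
    have h7 : L * (r ^ 2 / 2) ≤ π * r := by
      calc L * (r ^ 2 / 2) ≤ L * (t * s) := by gcongr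
        _ = t * L * s := by ring
        _ ≤ _ := hmain
    have : r * (L * r) ≤ r * (2 * π) := by nlinarith
    have := le_of_mul_le_mul_left this hr0
    linarith
  · push Not at hcase
    have h8 : r ^ 4 / 2 ≤ r * (2 * |a| + r) := by
      have e : |t ^ 2 - a ^ 2| ≤ t ^ 2 * s ^ 2 + |t * c - a| * |t * c + a| := by
        rw [← abs_mul]
        have : t ^ 2 - a ^ 2 = t ^ 2 * s ^ 2 + (t * c - a) * (t * c + a) := by
          linear_combination -t ^ 2 * hsc
        rw [this]
        exact (abs_add_le _ _).trans (by rw [abs_of_nonneg (a := t ^ 2 * s ^ 2) (by positivity)])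
      have e1 : |t * c - a| ≤ r := abs_le.mpr ⟨by linarith, by linarith⟩
      have e2 : |t * c + a| ≤ 2 * |a| + r := by
        have : t * c + a = (t * c - a) + 2 * a := by ring
        rw [this]
        refine (abs_add_le _ _).trans ?_
        rw [abs_mul, abs_two]; linarith
      have e3 : |t * c - a| * |t * c + a| ≤ r * (2 * |a| + r) := by gcongr
      linarith
    have h9 : r ^ 3 / 4 - r / 2 ≤ |a| := by
      have : r * (r ^ 3 / 2) ≤ r * (2 * |a| + r) := by linarith
      have := le_of_mul_le_mul_left this hr0
      linarith
    have h10 : |a| - r ≤ t := by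
      have e0 : |t * c| ≤ t := by
        rw [abs_mul, abs_of_pos ht]
        exact mul_le_of_le_one_right ht.le (Real.abs_cos_le_one m)
      have e1 : |a - t * c| ≤ r := abs_le.mpr ⟨by linarith, by linarith⟩
      have := abs_sub_abs_le_abs_sub a (t * c)
      linarith
    have h11 : r ^ 3 / 8 ≤ t := by nlinarith [mul_nonneg hr0.le (sub_nonneg.mpr hr)]
    have h12 : t * L * (L / π) ≤ π * r := by
      refine le_trans ?_ hmain
      gcongr
    have h13 : r ^ 3 / 8 * L ^ 2 ≤ π ^ 2 * r := by
      have : t * L * (L / π) = t * L ^ 2 / π := by ring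
      rw [this, div_le_iff₀ hpi] at h12
      calc r ^ 3 / 8 * L ^ 2 ≤ t * L ^ 2 := by gcongr
        _ ≤ _ := h12
        _ = _ := by ring
    have h14 : (L * r) ^ 2 ≤ 9 ^ 2 := by
      have : r * (L * r) ^ 2 ≤ r * (8 * π ^ 2) := by nlinarith
      have := le_of_mul_le_mul_left this hr0
      nlinarith
    exact le_of_sq_le_sq h14 (by norm_num)

/-- Uniform van der Corput bound for the Bessel phase. -/
lemma norm_integral_phase_le {t a r : ℝ} (ht : 0 < t) (hr : 4 ≤ r)
    (hD : r ^ 4 = |t ^ 2 - a ^ 2|) :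
    ‖∫ u in (0 : ℝ)..π, Complex.exp (Complex.I * ((t * Real.sin u - a * u : ℝ) : ℂ))‖ ≤
      15 / r := by
  have hr0 : 0 < r := by linarith
  set x₁ := (a + r) / t with hx₁
  set x₂ := (a - r) / t with hx₂
  have hx : x₂ ≤ x₁ := by rw [hx₁, hx₂]; gcongr; linarith
  have htx₁ : t * x₁ = a + r := by rw [hx₁]; field_simp
  have htx₂ : t * x₂ = a - r := by rw [hx₂]; field_simp
  set u := Real.arccos x₁ with hu
  set v := Real.arccos x₂ with hv
  have huv : u ≤ v := Real.arccos_le_arccos hx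
  have hu0 : 0 ≤ u := Real.arccos_nonneg _
  have hvpi : v ≤ π := Real.arccos_le_pi _
  have hcont : Continuous fun u : ℝ =>
      Complex.exp (Complex.I * ((t * Real.sin u - a * u : ℝ) : ℂ)) := by fun_prop
  have hint : ∀ p q : ℝ, IntervalIntegrable (fun u : ℝ =>
      Complex.exp (Complex.I * ((t * Real.sin u - a * u : ℝ) : ℂ))) volume p q :=
    fun p q => hcont.intervalIntegrable p q
  have hb1 : ‖∫ w in (0 : ℝ)..u, Complex.exp (Complex.I * ((t * Real.sin w - a * w : ℝ) : ℂ))‖ ≤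
      3 / r := by
    by_cases h1 : 1 ≤ x₁
    · rw [hu, Real.arccos_of_one_le h1]; simp; positivity
    · push Not at h1
      apply norm_integral_phase_le_of_deriv ht.le le_rfl hu0 (huv.trans hvpi) hr0
      left
      intro w hw
      have : x₁ ≤ Real.cos w := by
        by_cases h2 : -1 ≤ x₁
        · rw [← Real.cos_arccos h2 h1.le]
          exact Real.cos_le_cos_of_nonneg_of_le_pi hw.1 (huv.trans hvpi) hw.2
        · push Not at h2
          exact h2.le.trans (Real.neg_one_le_cos w)
      nlinarith
  have hb3 : ‖∫ w in v..π, Complex.exp (Complex.I * ((t * Real.sin w - a * w : ℝ) : ℂ))‖ ≤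
      3 / r := by
    by_cases h1 : x₂ ≤ -1
    · rw [hv, Real.arccos_of_le_neg_one h1]; simp; positivity
    · push Not at h1
      apply norm_integral_phase_le_of_deriv ht.le (hu0.trans huv) hvpi le_rfl hr0
      right
      intro w hw
      have : Real.cos w ≤ x₂ := by
        by_cases h2 : x₂ ≤ 1
        · rw [← Real.cos_arccos h1.le h2]
          exact Real.cos_le_cos_of_nonneg_of_le_pi (hu0.trans huv) hw.2 hw.1
        · push Not at h2
          exact (Real.cos_le_one w).trans h2.le
      nlinarith
  have hb2 : ‖∫ w in u..v, Complex.exp (Complex.I * ((t * Real.sin w - a * w : ℝ) : ℂ))‖ ≤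
      9 / r := by
    rcases huv.eq_or_lt with h | h
    · rw [h]; simp; positivity
    · have hx1 : -1 < x₁ := by
        by_contra! hc
        have : u = π := Real.arccos_of_le_neg_one hc
        linarith
      have hx2 : x₂ < 1 := by
        by_contra! hc
        have : v = 0 := Real.arccos_of_one_le hc
        linarith
      have h1 : t * Real.cos u ≤ a + r := by
        rw [← htx₁]
        gcongr
        by_cases hc : x₁ ≤ 1
        · rw [hu, Real.cos_arccos hx1.le hc]
        · push Not at hc
          exact (Real.cos_le_one _).trans hc.le
      have h2 : a - r ≤ t * Real.cos v := by
        rw [← htx₂]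
        gcongr
        by_cases hc : -1 ≤ x₂
        · rw [hv, Real.cos_arccos hc hx2.le]
        · push Not at hc
          exact hc.le.trans (Real.neg_one_le_cos _)
      refine le_trans ?_ (level_set_length_le ht hr hD hu0 h hvpi h1 h2)
      have := intervalIntegral.norm_integral_le_of_norm_le_const (a := u) (b := v) (C := 1)
        (f := fun w : ℝ => Complex.exp (Complex.I * ((t * Real.sin w - a * w : ℝ) : ℂ)))
        (fun w _ => (Complex.norm_exp_I_mul_ofReal _).le)
      rwa [one_mul, abs_of_nonneg (sub_nonneg.mpr huv)] at this
  rw [← intervalIntegral.integral_add_adjacent_intervals (hint 0 u) (hint u π),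
    ← intervalIntegral.integral_add_adjacent_intervals (hint u v) (hint v π)]
  refine (norm_add_le _ _).trans ((add_le_add hb1 ((norm_add_le _ _).trans
    (add_le_add hb2 hb3))).trans (le_of_eq ?_))
  ring

end OscillatoryIntegral

section Bessel

/-- The Bessel function `J_n(t)` of integer order. -/
def besselJ (n : ℤ) (t : ℝ) : ℂ :=
  (((2 * π)⁻¹ : ℝ) : ℂ) *
    ∫ θ in (-π)..π, Complex.exp (Complex.I * ((t * Real.sin θ - n * θ : ℝ) : ℂ))

lemma norm_besselJ_le_one (n : ℤ) (t : ℝ) : ‖besselJ n t‖ ≤ 1 := by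
  have hpi := Real.pi_pos
  have := intervalIntegral.norm_integral_le_of_norm_le_const (a := -π) (b := π) (C := 1)
    (f := fun θ : ℝ => Complex.exp (Complex.I * ((t * Real.sin θ - n * θ : ℝ) : ℂ)))
    (fun w _ => (Complex.norm_exp_I_mul_ofReal _).le)
  rw [besselJ, norm_mul, Complex.norm_real, Real.norm_eq_abs, abs_of_pos (by positivity),
    inv_mul_le_iff₀ (by positivity)]
  refine this.trans (le_of_eq ?_)
  rw [abs_of_pos (by linarith)]; ring

lemma norm_besselJ_le {n : ℤ} {t : ℝ} (ht : 0 < t) (hD : 0 < |t ^ 2 - (n : ℝ) ^ 2|) :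
    ‖besselJ n t‖ ≤ 5 * |t ^ 2 - (n : ℝ) ^ 2| ^ (-(1 / 4) : ℝ) := by
  have hpi := Real.pi_pos
  have hpi3 := Real.pi_gt_three
  set D := |t ^ 2 - (n : ℝ) ^ 2| with hDdef
  set r : ℝ := D ^ ((1 / 4) : ℝ) with hr
  have hr0 : 0 < r := Real.rpow_pos_of_pos hD _
  have hr4 : r ^ 4 = D := by
    rw [hr, ← Real.rpow_natCast, ← Real.rpow_mul hD.le]; norm_num
  have hneg : D ^ (-(1 / 4) : ℝ) = r⁻¹ := Real.rpow_neg hD.le _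
  rw [hneg]
  by_cases h4 : 4 ≤ r
  · have key := norm_integral_phase_le (a := (n : ℝ)) ht h4 hr4
    set E : ℝ → ℂ := fun θ => Complex.exp (Complex.I * ((t * Real.sin θ - n * θ : ℝ) : ℂ)) with hE
    have hcont : Continuous E := by simp only [hE]; fun_prop
    have hneg : ‖∫ θ in (-π)..0, E θ‖ = ‖∫ θ in (0 : ℝ)..π, E θ‖ := by
      have h1 : ∫ θ in (-π)..0, E θ = ∫ θ in (0 : ℝ)..π, E (-θ) := by
        rw [intervalIntegral.integral_comp_neg]; simp
      have h2 : ∀ θ, E (-θ) = (starRingEnd ℂ) (E θ) := by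
        intro θ
        simp only [hE, ← Complex.exp_conj, map_mul, Complex.conj_I, Complex.conj_ofReal,
          Real.sin_neg]
        congr 1
        push_cast; ring
      rw [h1]
      simp_rw [h2]
      rw [intervalIntegral.integral_of_le hpi.le, intervalIntegral.integral_of_le hpi.le,
        integral_conj, RCLike.norm_conj]
    rw [besselJ, norm_mul, Complex.norm_real, Real.norm_eq_abs, abs_of_pos (by positivity),
      ← intervalIntegral.integral_add_adjacent_intervals (hcont.intervalIntegrable (-π) 0)
        (hcont.intervalIntegrable 0 π), inv_mul_le_iff₀ (by positivity)]
    refine (norm_add_le _ _).trans ?_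
    rw [hneg]
    calc _ ≤ 15 / r + 15 / r := add_le_add key key
      _ = 2 * 3 * (5 * r⁻¹) := by ring
      _ ≤ 2 * π * (5 * r⁻¹) := by gcongr
  · push Not at h4
    refine (norm_besselJ_le_one n t).trans ?_
    rw [← div_eq_mul_inv, le_div_iff₀ hr0]
    linarith

lemma hasDerivAt_besselJ (n : ℤ) (t : ℝ) :
    HasDerivAt (besselJ n) ((besselJ (n - 1) t - besselJ (n + 1) t) / 2) t := by
  have hcont : ∀ (m : ℤ) (t : ℝ), Continuous fun θ : ℝ =>
      Complex.exp (Complex.I * ((t * Real.sin θ - m * θ : ℝ) : ℂ)) := by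
    intro m t; fun_prop
  have hcont' : Continuous fun θ : ℝ => Complex.I * (Real.sin θ : ℂ) *
      Complex.exp (Complex.I * ((t * Real.sin θ - n * θ : ℝ) : ℂ)) := by fun_prop
  have h := (intervalIntegral.hasDerivAt_integral_of_dominated_loc_of_deriv_le (μ := volume)
    (a := -π) (b := π) (x₀ := t) (s := Set.univ) (bound := fun _ => 1)
    (F := fun t θ => Complex.exp (Complex.I * ((t * Real.sin θ - n * θ : ℝ) : ℂ)))
    (F' := fun t θ => Complex.I * (Real.sin θ : ℂ) *
      Complex.exp (Complex.I * ((t * Real.sin θ - n * θ : ℝ) : ℂ)))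
    Filter.univ_mem (Filter.Eventually.of_forall fun s => (hcont n s).aestronglyMeasurable)
    ((hcont n t).intervalIntegrable _ _) hcont'.aestronglyMeasurable
    (Filter.Eventually.of_forall fun θ _ s _ => by
      rw [norm_mul, norm_mul, Complex.norm_exp_I_mul_ofReal, Complex.norm_real]
      simpa using Real.abs_sin_le_one θ)
    (by simp)
    (Filter.Eventually.of_forall fun θ _ s _ => by
      have h1 : HasDerivAt (fun s : ℝ => s * Real.sin θ - n * θ) (Real.sin θ) s := by
        simpa using ((hasDerivAt_id s).mul_const (Real.sin θ)).sub_const ((n : ℝ) * θ)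
      refine (((h1.ofReal_comp).const_mul Complex.I).cexp).congr_deriv ?_
      ring)).2
  refine (h.const_mul (((2 * π)⁻¹ : ℝ) : ℂ)).congr_deriv ?_
  simp only [besselJ]
  rw [← mul_sub, mul_div_assoc, ← intervalIntegral.integral_sub
    ((hcont _ t).intervalIntegrable _ _) ((hcont _ t).intervalIntegrable _ _),
    ← intervalIntegral.integral_div]
  congr 1
  apply intervalIntegral.integral_congr
  intro θ _
  have e1 : Complex.exp (Complex.I * ((t * Real.sin θ - (n - 1 : ℤ) * θ : ℝ) : ℂ)) =
      Complex.exp ((θ : ℂ) * Complex.I) *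
        Complex.exp (Complex.I * ((t * Real.sin θ - n * θ : ℝ) : ℂ)) := by
    rw [← Complex.exp_add]; congr 1; push_cast; ring
  have e2 : Complex.exp (Complex.I * ((t * Real.sin θ - (n + 1 : ℤ) * θ : ℝ) : ℂ)) =
      Complex.exp (-(θ : ℂ) * Complex.I) *
        Complex.exp (Complex.I * ((t * Real.sin θ - n * θ : ℝ) : ℂ)) := by
    rw [← Complex.exp_add]; congr 1; push_cast; ring
  simp only [e1, e2]
  rw [Complex.exp_mul_I, Complex.exp_mul_I, Complex.cos_neg, Complex.sin_neg, Complex.ofReal_sin]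
  ring

lemma continuous_besselJ (n : ℤ) : Continuous (besselJ n) :=
  continuous_iff_continuousAt.mpr fun t => (hasDerivAt_besselJ n t).continuousAt

lemma besselJ_eq_fourierCoeffOn (n : ℤ) (t : ℝ) (h : -π < π) :
    besselJ n t =
      fourierCoeffOn h (fun θ : ℝ => Complex.exp (Complex.I * ((t * Real.sin θ : ℝ) : ℂ))) n := by
  rw [fourierCoeffOn_eq_integral, besselJ, Complex.real_smul]
  congr 1
  · congr 1; rw [one_div]; congr 1; ring
  · apply intervalIntegral.integral_congr
    intro θ _
    simp only [fourier_coe_apply, smul_eq_mul]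
    rw [← Complex.exp_add]
    congr 1
    have : (π : ℂ) ≠ 0 := by exact_mod_cast Real.pi_ne_zero
    push_cast
    field_simp
    ring

lemma hasSum_norm_besselJ_sq (t : ℝ) : HasSum (fun n => ‖besselJ n t‖ ^ 2) 1 := by
  have hpi := Real.pi_pos
  have h : -π < π := by linarith
  have hc : Continuous fun θ : ℝ => Complex.exp (Complex.I * ((t * Real.sin θ : ℝ) : ℂ)) := by
    fun_prop
  have := hasSum_sq_fourierCoeffOn h
    (f := fun θ : ℝ => Complex.exp (Complex.I * ((t * Real.sin θ : ℝ) : ℂ)))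
    (MemLp.of_bound hc.aestronglyMeasurable 1
      (Filter.Eventually.of_forall fun θ => (Complex.norm_exp_I_mul_ofReal _).le))
  simp_rw [besselJ_eq_fourierCoeffOn _ t h]
  convert this using 1
  simp_rw [Complex.norm_exp_I_mul_ofReal]
  simp only [one_pow, intervalIntegral.integral_const, smul_eq_mul, mul_one]
  field_simp

lemma besselJ_zero (n : ℤ) : besselJ n 0 = if n = 0 then 1 else 0 := by
  have hpi := Real.pi_pos
  have hpic : (π : ℂ) ≠ 0 := by exact_mod_cast Real.pi_ne_zero
  rw [besselJ]
  split_ifs with h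
  · subst h
    simp
    rw [← two_mul]
    field_simp
  · have hn : (-(n : ℂ) * Complex.I) ≠ 0 := by simp [h]
    have := integral_exp_mul_complex (a := -π) (b := π) hn
    have h2 : (∫ θ in (-π)..π, Complex.exp (Complex.I * ((0 * Real.sin θ - n * θ : ℝ) : ℂ))) =
        ∫ θ in (-π)..π, Complex.exp (-(n : ℂ) * Complex.I * (θ : ℂ)) := by
      apply intervalIntegral.integral_congr
      intro θ _
      simp only
      congr 1
      push_cast; ring
    rw [h2, this]
    have h3 : Complex.exp (-(n : ℂ) * Complex.I * ((-π : ℝ) : ℂ)) =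
        Complex.exp (-(n : ℂ) * Complex.I * (π : ℂ)) := by
      rw [Complex.exp_eq_exp_iff_exists_int]
      exact ⟨n, by push_cast; ring⟩
    rw [h3]; simp

lemma tendsto_besselJ_atTop (n : ℤ) :
    Filter.Tendsto (besselJ n) Filter.atTop (nhds 0) := by
  have h1 : Filter.Tendsto (fun t : ℝ => |t ^ 2 - (n : ℝ) ^ 2|) Filter.atTop Filter.atTop := by
    apply Filter.tendsto_abs_atTop_atTop.comp
    exact Filter.tendsto_atTop_add_const_right _ _ (Filter.tendsto_pow_atTop two_ne_zero)
  have h2 : Filter.Tendsto (fun t : ℝ => 5 * |t ^ 2 - (n : ℝ) ^ 2| ^ (-(1 / 4) : ℝ))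
      Filter.atTop (nhds 0) := by
    simpa using ((tendsto_rpow_neg_atTop (y := 1 / 4) (by norm_num)).comp h1).const_mul 5
  apply squeeze_zero_norm' _ h2
  filter_upwards [Filter.eventually_gt_atTop 0, h1.eventually_gt_atTop 0] with t ht hD
  exact norm_besselJ_le ht hD

end Bessel

section BesselIntegrals

lemma integrableOn_abs_sq_sub_one_rpow :
    IntegrableOn (fun s : ℝ => |s ^ 2 - 1| ^ (-(3 / 4) : ℝ)) (Set.Ioi 0) := by
  have hmeas : Measurable fun s : ℝ => |s ^ 2 - 1| ^ (-(3 / 4) : ℝ) := by fun_prop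
  have hle : ∀ s : ℝ, 0 ≤ s → |s ^ 2 - 1| ^ (-(3 / 4) : ℝ) ≤ |s - 1| ^ (-(3 / 4) : ℝ) := by
    intro s hs
    rcases eq_or_ne s 1 with rfl | h1
    · simp
    · apply Real.rpow_le_rpow_of_nonpos (abs_pos.mpr (sub_ne_zero.mpr h1)) _ (by norm_num)
      rw [show s ^ 2 - 1 = (s - 1) * (s + 1) by ring, abs_mul]
      exact le_mul_of_one_le_right (abs_nonneg _) (by rw [abs_of_pos] <;> linarith)
  rw [← Set.Ioc_union_Ioi_eq_Ioi (show (0 : ℝ) ≤ 1 by norm_num),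
    ← Set.Ioc_union_Ioi_eq_Ioi (show (1 : ℝ) ≤ 2 by norm_num)]
  refine IntegrableOn.union ?_ (IntegrableOn.union ?_ ?_)
  · have h := (intervalIntegral.intervalIntegrable_rpow' (a := 1) (b := 0) (r := -(3 / 4))
      (by norm_num)).comp_sub_left 1
    norm_num at h
    rw [intervalIntegrable_iff_integrableOn_Ioc_of_le zero_le_one] at h
    refine Integrable.mono' h hmeas.aestronglyMeasurable ?_
    filter_upwards [ae_restrict_mem measurableSet_Ioc] with s hs
    rw [Real.norm_of_nonneg (by positivity)]
    refine (hle s hs.1.le).trans (le_of_eq ?_)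
    rw [abs_sub_comm, abs_of_nonneg (by linarith [hs.2])]
  · have h := (intervalIntegral.intervalIntegrable_rpow' (a := 0) (b := 1) (r := -(3 / 4))
      (by norm_num)).comp_sub_right 1
    norm_num at h
    rw [intervalIntegrable_iff_integrableOn_Ioc_of_le one_le_two] at h
    refine Integrable.mono' h hmeas.aestronglyMeasurable ?_
    filter_upwards [ae_restrict_mem measurableSet_Ioc] with s hs
    rw [Real.norm_of_nonneg (by positivity)]
    refine (hle s (by linarith [hs.1])).trans (le_of_eq ?_)
    rw [abs_of_nonneg (by linarith [hs.1])]
  · have h := (integrableOn_Ioi_rpow_of_lt (a := -(3 / 2)) (by norm_num)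
      (show (0 : ℝ) < 2 by norm_num)).mul_const ((1 / 4 : ℝ) ^ (-(3 / 4) : ℝ))
    refine Integrable.mono' h hmeas.aestronglyMeasurable ?_
    filter_upwards [ae_restrict_mem measurableSet_Ioi] with s hs
    have hs' : 2 < s := hs
    rw [Real.norm_of_nonneg (by positivity)]
    have e : s ^ (-(3 / 2) : ℝ) = (s ^ 2) ^ (-(3 / 4) : ℝ) := by
      rw [← Real.rpow_natCast, ← Real.rpow_mul (by linarith)]; norm_num
    rw [e, ← Real.mul_rpow (by positivity) (by norm_num)]
    apply Real.rpow_le_rpow_of_nonpos (by positivity) _ (by norm_num)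
    rw [abs_of_nonneg] <;> nlinarith

/-- The integral `∫₀^∞ |J_n(t)|³ dt`. -/
def besselCube (n : ℤ) : ℝ≥0∞ := ∫⁻ t in Set.Ioi (0 : ℝ), ‖besselJ n t‖ₑ ^ 3

lemma enorm_besselJ_cube_le {n : ℤ} {t : ℝ} (ht : 0 < t) (hD : 0 < |t ^ 2 - (n : ℝ) ^ 2|) :
    ‖besselJ n t‖ₑ ^ 3 ≤ ENNReal.ofReal (125 * |t ^ 2 - (n : ℝ) ^ 2| ^ (-(3 / 4) : ℝ)) := by
  rw [← ofReal_norm, ← ENNReal.ofReal_pow (norm_nonneg _)]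
  apply ENNReal.ofReal_le_ofReal
  calc ‖besselJ n t‖ ^ 3 ≤ (5 * |t ^ 2 - (n : ℝ) ^ 2| ^ (-(1 / 4) : ℝ)) ^ 3 := by
        gcongr; exact norm_besselJ_le ht hD
    _ = 125 * |t ^ 2 - (n : ℝ) ^ 2| ^ (-(3 / 4) : ℝ) := by
        rw [mul_pow, ← Real.rpow_natCast (|t ^ 2 - (n : ℝ) ^ 2| ^ (-(1 / 4) : ℝ)),
          ← Real.rpow_mul (abs_nonneg _)]
        norm_num

lemma besselCube_zero_lt_top : besselCube 0 < ∞ := by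
  rw [besselCube, ← Set.Ioc_union_Ioi_eq_Ioi (show (0 : ℝ) ≤ 1 by norm_num)]
  refine (lintegral_union_le _ _ _).trans_lt (ENNReal.add_lt_top.mpr ⟨?_, ?_⟩)
  · calc ∫⁻ t in Set.Ioc (0 : ℝ) 1, ‖besselJ 0 t‖ₑ ^ 3 ≤ ∫⁻ _ in Set.Ioc (0 : ℝ) 1, 1 := by
          gcongr with t
          apply pow_le_one₀ zero_le
          rw [← ofReal_norm]
          exact ENNReal.ofReal_le_one.mpr (norm_besselJ_le_one 0 t)
      _ < ∞ := by simp
  · have h := ((integrableOn_Ioi_rpow_of_lt (a := -(3 / 2)) (by norm_num)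
      (show (0 : ℝ) < 1 by norm_num)).const_mul 125).lintegral_lt_top
    refine lt_of_le_of_lt (setLIntegral_mono_ae (by fun_prop) ?_) h
    refine Filter.Eventually.of_forall fun t ht => ?_
    have ht1 : (1 : ℝ) < t := ht
    have ht0 : (0 : ℝ) < t := by linarith
    have hpos : 0 < |t ^ 2 - ((0 : ℤ) : ℝ) ^ 2| := by
      rw [Int.cast_zero, zero_pow two_ne_zero, sub_zero]
      exact abs_pos.mpr (pow_pos ht0 2).ne'
    refine (enorm_besselJ_cube_le ht0 hpos).trans (le_of_eq ?_)
    congr 2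
    rw [Int.cast_zero, zero_pow two_ne_zero, sub_zero, abs_of_nonneg (sq_nonneg t),
      ← Real.rpow_natCast, ← Real.rpow_mul ht0.le]
    norm_num

lemma exists_besselCube_le : ∃ M : ℝ, 0 ≤ M ∧ ∀ n : ℤ, n ≠ 0 →
    besselCube n ≤ ENNReal.ofReal (M * |(n : ℝ)| ^ (-(1 / 2) : ℝ)) := by
  set c := ∫ s in Set.Ioi (0 : ℝ), |s ^ 2 - 1| ^ (-(3 / 4) : ℝ) with hc
  have hc0 : 0 ≤ c := integral_nonneg fun s => by positivity
  refine ⟨125 * c, by positivity, fun n hn => ?_⟩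
  have hk : 0 < |(n : ℝ)| := abs_pos.mpr (by exact_mod_cast hn)
  set k := |(n : ℝ)| with hkdef
  have hk2 : (n : ℝ) ^ 2 = k ^ 2 := (sq_abs _).symm
  set F : ℝ → ℝ := fun t => 125 * |t ^ 2 - (n : ℝ) ^ 2| ^ (-(3 / 4) : ℝ) with hF
  have hscale : ∀ s : ℝ, F (k * s) =
      125 * k ^ (-(3 / 2) : ℝ) * |s ^ 2 - 1| ^ (-(3 / 4) : ℝ) := by
    intro s
    have e : k ^ (-(3 / 2) : ℝ) = (k ^ 2) ^ (-(3 / 4) : ℝ) := by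
      rw [← Real.rpow_natCast, ← Real.rpow_mul hk.le]; norm_num
    rw [e, mul_assoc, ← Real.mul_rpow (by positivity) (by positivity), hF]
    simp only
    rw [hk2, show (k * s) ^ 2 - k ^ 2 = k ^ 2 * (s ^ 2 - 1) by ring, abs_mul,
      abs_of_nonneg (sq_nonneg k)]
  have hint : IntegrableOn F (Set.Ioi 0) := by
    have := (integrableOn_Ioi_comp_mul_left_iff F 0 hk).mp
      (by simp_rw [hscale]; exact integrableOn_abs_sq_sub_one_rpow.const_mul _)
    simpa using this
  have hval : ∫ t in Set.Ioi (0 : ℝ), F t = 125 * c * k ^ (-(1 / 2) : ℝ) := by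
    have h1 := integral_comp_mul_left_Ioi F 0 hk
    simp_rw [hscale] at h1
    rw [integral_const_mul, ← hc, mul_zero, smul_eq_mul, eq_inv_mul_iff_mul_eq₀ hk.ne'] at h1
    rw [← h1]
    have e : k ^ (-(1 / 2) : ℝ) = k * k ^ (-(3 / 2) : ℝ) := by
      nth_rewrite 2 [← Real.rpow_one k]
      rw [← Real.rpow_add hk]; norm_num
    rw [e]; ring
  rw [← hval, ofReal_integral_eq_lintegral_ofReal hint
    (Filter.Eventually.of_forall fun t => by simp only [hF]; positivity)]
  apply lintegral_mono_ae
  filter_upwards [ae_restrict_mem measurableSet_Ioi,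
    (ae_restrict_of_ae (Measure.ae_ne volume k))] with t ht hne
  refine enorm_besselJ_cube_le ht (abs_pos.mpr ?_)
  rw [hk2, sub_ne_zero]
  intro h
  exact hne ((pow_left_inj₀ (le_of_lt ht) hk.le two_ne_zero).mp h)

lemma tsum_besselCube_rpow_lt_top : ∑' n : ℤ, besselCube n ^ (7 / 3 : ℝ) < ∞ := by
  obtain ⟨M, hM, hle⟩ := exists_besselCube_le
  have hsum : Summable fun n : ℤ => M ^ (7 / 3 : ℝ) * |(n : ℝ)| ^ (-(7 / 6) : ℝ) :=
    (Real.summable_abs_int_rpow (b := 7 / 6) (by norm_num)).mul_left _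
  calc ∑' n : ℤ, besselCube n ^ (7 / 3 : ℝ)
      ≤ ∑' n : ℤ, ((if n = 0 then besselCube 0 ^ (7 / 3 : ℝ) else 0) +
          ENNReal.ofReal (M ^ (7 / 3 : ℝ) * |(n : ℝ)| ^ (-(7 / 6) : ℝ))) := by
        gcongr with n
        split_ifs with h
        · subst h; exact le_self_add
        · rw [zero_add]
          calc besselCube n ^ (7 / 3 : ℝ)
              ≤ ENNReal.ofReal (M * |(n : ℝ)| ^ (-(1 / 2) : ℝ)) ^ (7 / 3 : ℝ) := by
                gcongr; exact hle n h
            _ = _ := by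
                rw [ENNReal.ofReal_rpow_of_nonneg (by positivity) (by norm_num),
                  Real.mul_rpow hM (by positivity), ← Real.rpow_mul (abs_nonneg _)]
                norm_num
    _ < ∞ := by
        rw [ENNReal.tsum_add, tsum_ite_eq]
        refine ENNReal.add_lt_top.mpr ⟨?_, ?_⟩
        · exact ENNReal.rpow_lt_top_of_nonneg (by norm_num) besselCube_zero_lt_top.ne
        · rw [← ENNReal.ofReal_tsum_of_nonneg (fun n => by positivity) hsum]
          exact ENNReal.ofReal_lt_top

lemma tsum_prod_apply_eq_pow (b : ℤ → ℝ≥0∞) (d : ℕ) :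
    ∑' x : Fin d → ℤ, ∏ j, b (x j) = (∑' n, b n) ^ d := by
  induction d with
  | zero => simp
  | succ d ih =>
    rw [← (Fin.consEquiv fun _ : Fin (d + 1) => ℤ).tsum_eq, ENNReal.tsum_prod', pow_succ', ← ih,
      ← ENNReal.tsum_mul_right]
    congr 1
    ext n
    rw [← ENNReal.tsum_mul_left]
    simp [Fin.consEquiv, Fin.prod_univ_succ]

/-- The integral over positive times of the modulus of the kernel of `exp (itA/2)`, where `A` is
the adjacency operator of `ℤ³`. -/
def greenBound (x : Fin 3 → ℤ) : ℝ≥0∞ :=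
  ∫⁻ t in Set.Ioi (0 : ℝ), ∏ j, ‖besselJ (x j) t‖ₑ

lemma greenBound_le (x : Fin 3 → ℤ) :
    greenBound x ≤ ∏ j, besselCube (x j) ^ (1 / 3 : ℝ) := by
  have := ENNReal.lintegral_prod_norm_pow_le (μ := volume.restrict (Set.Ioi (0 : ℝ)))
    (Finset.univ : Finset (Fin 3)) (f := fun j t => ‖besselJ (x j) t‖ₑ ^ 3)
    (fun j _ => ((continuous_besselJ (x j)).enorm.measurable.pow_const 3).aemeasurable)
    (p := fun _ => 1 / 3) (by simp) (fun _ _ => by norm_num)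
  refine le_trans (le_of_eq ?_) this
  rw [greenBound]
  congr 1
  ext t
  apply Finset.prod_congr rfl
  intro j _
  rw [← ENNReal.rpow_natCast, ← ENNReal.rpow_mul]
  norm_num

lemma tsum_greenBound_rpow_lt_top : ∑' x, greenBound x ^ (7 : ℝ) < ∞ := by
  calc ∑' x, greenBound x ^ (7 : ℝ)
      ≤ ∑' x : Fin 3 → ℤ, ∏ j, besselCube (x j) ^ (7 / 3 : ℝ) := by
        gcongr with x
        refine (ENNReal.rpow_le_rpow (greenBound_le x) (by norm_num)).trans (le_of_eq ?_)
        rw [← ENNReal.prod_rpow_of_nonneg (by norm_num)]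
        apply Finset.prod_congr rfl
        intro j _
        rw [← ENNReal.rpow_mul]
        norm_num
    _ < ∞ := by
        rw [tsum_prod_apply_eq_pow fun n => besselCube n ^ (7 / 3 : ℝ)]
        exact ENNReal.pow_lt_top tsum_besselCube_rpow_lt_top

end BesselIntegrals

section LatticeResolvent

/-- The adjacency operator of the lattice `ℤ³`. -/
def adj (g : (Fin 3 → ℤ) → ℂ) (x : Fin 3 → ℤ) : ℂ :=
  ∑ j, (g (x + Pi.single j 1) + g (x - Pi.single j 1))

lemma hasSum_of_forall_eq {ι E : Type*} [AddCommMonoid E] [TopologicalSpace E] {f g : ι → E}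
    {a : E} (h : ∀ i, g i = f i) (hf : HasSum f a) : HasSum g a := by
  rwa [funext h]

lemma hasSum_mul_shift {W ψ : (Fin 3 → ℤ) → ℂ}
    (h : ∀ x, Summable fun y => W (x - y) * ψ y) (x e : Fin 3 → ℤ) :
    HasSum (fun y => W (x - y) * ψ (y + e)) (∑' y, W (x + e - y) * ψ y) := by
  have := (Equiv.addRight e).hasSum_iff.mpr (h (x + e)).hasSum
  convert this using 2 with y
  simp

lemma hasSum_mul_adj {W ψ : (Fin 3 → ℤ) → ℂ}
    (h : ∀ x, Summable fun y => W (x - y) * ψ y) (x : Fin 3 → ℤ) :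
    HasSum (fun y => W (x - y) * adj ψ y) (adj (fun z => ∑' y, W (z - y) * ψ y) x) := by
  simp only [adj, Finset.mul_sum, mul_add]
  refine hasSum_sum fun j _ => (hasSum_mul_shift h x _).add ?_
  simpa [sub_eq_add_neg] using hasSum_mul_shift h x (-Pi.single j 1)

lemma hasSum_adj_mul {W ψ : (Fin 3 → ℤ) → ℂ}
    (h : ∀ x, Summable fun y => W (x - y) * ψ y) (x : Fin 3 → ℤ) :
    HasSum (fun y => adj W (x - y) * ψ y) (adj (fun z => ∑' y, W (z - y) * ψ y) x) := by
  simp only [adj, Finset.sum_mul, add_mul]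
  refine hasSum_sum fun j _ => HasSum.add ?_ ?_
  · have hx := h (x + (Pi.single j 1 : Fin 3 → ℤ))
    exact hasSum_of_forall_eq (fun y => by rw [sub_add_eq_add_sub]) hx.hasSum
  · have hx := h (x - (Pi.single j 1 : Fin 3 → ℤ))
    exact hasSum_of_forall_eq (fun y => by rw [sub_right_comm]) hx.hasSum

/-- The kernel of `exp (itA/2)`, where `A` is the adjacency operator of `ℤ³`. -/
def latticeProp (x : Fin 3 → ℤ) (t : ℝ) : ℂ := ∏ j, (Complex.I ^ x j * besselJ (x j) t)

lemma enorm_latticeProp (x : Fin 3 → ℤ) (t : ℝ) :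
    ‖latticeProp x t‖ₑ = ∏ j, ‖besselJ (x j) t‖ₑ := by
  have h : ‖latticeProp x t‖ = ∏ j, ‖besselJ (x j) t‖ := by
    rw [latticeProp, norm_prod]
    simp [norm_zpow]
  rw [← ofReal_norm, h, ENNReal.ofReal_prod_of_nonneg fun _ _ => norm_nonneg _]
  simp

lemma hasDerivAt_I_zpow_mul_besselJ (n : ℤ) (t : ℝ) :
    HasDerivAt (fun t => Complex.I ^ n * besselJ n t) (Complex.I / 2 *
      (Complex.I ^ (n + 1) * besselJ (n + 1) t + Complex.I ^ (n - 1) * besselJ (n - 1) t)) t := by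
  refine ((hasDerivAt_besselJ n t).const_mul (Complex.I ^ n)).congr_deriv ?_
  rw [zpow_add_one₀ Complex.I_ne_zero, zpow_sub_one₀ Complex.I_ne_zero, Complex.inv_I]
  linear_combination (Complex.I ^ n * (besselJ (n - 1) t - besselJ (n + 1) t) / 2) *
    Complex.I_mul_I

lemma hasDerivAt_latticeProp (x : Fin 3 → ℤ) (t : ℝ) :
    HasDerivAt (latticeProp x) (Complex.I / 2 * adj (fun y => latticeProp y t) x) t := by
  have h := HasDerivAt.fun_finsetProd (u := (Finset.univ : Finset (Fin 3)))
    (f := fun j t => Complex.I ^ x j * besselJ (x j) t)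
    (fun j _ => hasDerivAt_I_zpow_mul_besselJ (x j) t)
  refine h.congr_deriv ?_
  simp only [adj, latticeProp, Finset.mul_sum]
  apply Finset.sum_congr rfl
  intro j _
  have h0 : (Finset.univ : Finset (Fin 3)).erase 0 = {1, 2} := by decide
  have h1 : (Finset.univ : Finset (Fin 3)).erase 1 = {0, 2} := by decide
  have h2 : (Finset.univ : Finset (Fin 3)).erase 2 = {0, 1} := by decide
  fin_cases j
  · simp [Fin.prod_univ_three, h0]
    ring
  · simp [Fin.prod_univ_three, h1]
    ring
  · simp [Fin.prod_univ_three, h2]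
    ring

lemma latticeProp_zero (x : Fin 3 → ℤ) : latticeProp x 0 = if x = 0 then 1 else 0 := by
  rw [latticeProp]
  split_ifs with h
  · subst h; simp [besselJ_zero]
  · obtain ⟨j, hj⟩ := Function.ne_iff.mp h
    apply Finset.prod_eq_zero (Finset.mem_univ j)
    rw [besselJ_zero, if_neg (by simpa using hj), mul_zero]

lemma tsum_enorm_latticeProp_sq (t : ℝ) : ∑' x, ‖latticeProp x t‖ₑ ^ 2 = 1 := by
  have h1 : ∑' n, ‖besselJ n t‖ₑ ^ 2 = 1 := by
    have h := hasSum_norm_besselJ_sq t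
    have h2 : ∀ n, ‖besselJ n t‖ₑ ^ 2 = ENNReal.ofReal (‖besselJ n t‖ ^ 2) := fun n => by
      rw [← ofReal_norm, ENNReal.ofReal_pow (norm_nonneg _)]
    simp_rw [h2]
    rw [← ENNReal.ofReal_tsum_of_nonneg (fun n => by positivity) h.summable, h.tsum_eq,
      ENNReal.ofReal_one]
  simp_rw [enorm_latticeProp, ← Finset.prod_pow]
  rw [tsum_prod_apply_eq_pow fun n => ‖besselJ n t‖ₑ ^ 2, h1, one_pow]

lemma tendsto_latticeProp_atTop (x : Fin 3 → ℤ) :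
    Filter.Tendsto (latticeProp x) Filter.atTop (nhds 0) := by
  have := tendsto_finsetProd (Finset.univ : Finset (Fin 3))
    (fun j _ => (tendsto_besselJ_atTop (x j)).const_mul (Complex.I ^ x j))
  have e : latticeProp x = fun t => ∏ j, (Complex.I ^ x j * besselJ (x j) t) := rfl
  rw [e]
  simpa using this

lemma continuous_latticeProp (x : Fin 3 → ℤ) : Continuous (latticeProp x) :=
  continuous_iff_continuousAt.mpr fun t => (hasDerivAt_latticeProp x t).continuousAt

lemma mul_le_sq_add_sq_ennreal (a b : ℝ≥0∞) : a * b ≤ a ^ 2 + b ^ 2 := by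
  rcases le_total a b with h | h
  · calc a * b ≤ b * b := by gcongr
      _ ≤ _ := by rw [sq b]; exact le_add_self
  · calc a * b ≤ a * a := by gcongr
      _ ≤ _ := by rw [sq a]; exact le_self_add

lemma summable_of_tsum_enorm_ne_top {ι : Type*} {f : ι → ℂ} (h : ∑' i, ‖f i‖ₑ ≠ ∞) :
    Summable f := by
  apply Summable.of_norm
  have := ENNReal.summable_toReal h
  simpa using this

lemma tsum_mul_le_Lp_mul_Lq {ι : Type*} {p q : ℝ} (hpq : p.HolderConjugate q)
    (f g : ι → ℝ≥0∞) :
    ∑' i, f i * g i ≤ (∑' i, f i ^ p) ^ (1 / p) * (∑' i, g i ^ q) ^ (1 / q) := by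
  let _ : MeasurableSpace ι := ⊤
  have := ENNReal.lintegral_mul_le_Lp_mul_Lq (μ := (Measure.count : Measure ι)) hpq
    (f := f) (g := g) measurable_from_top.aemeasurable measurable_from_top.aemeasurable
  simpa [lintegral_count] using this

/-- Pairing a square summable sequence with a bounded family in `ℓ²` that tends to zero
pointwise. -/
lemma tendsto_tsum_mul_zero {ι : Type*} {u : ℝ → ι → ℂ} {ψ : ι → ℂ}
    (hu : ∀ T, ∑' i, ‖u T i‖ₑ ^ 2 ≤ 1) (hψ : ∑' i, ‖ψ i‖ₑ ^ 2 ≠ ∞)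
    (h0 : ∀ i, Filter.Tendsto (fun T => u T i) Filter.atTop (nhds 0)) :
    Filter.Tendsto (fun T => ∑' i, ‖u T i‖ₑ * ‖ψ i‖ₑ) Filter.atTop (nhds 0) := by
  have htail : Filter.Tendsto (fun s : Finset ι =>
      (∑' i : { i // i ∉ s }, ‖ψ i‖ₑ ^ 2) ^ (1 / 2 : ℝ)) Filter.atTop (nhds 0) := by
    have h := (ENNReal.tendsto_tsum_compl_atTop_zero hψ).ennrpow_const (1 / 2 : ℝ)
    rwa [ENNReal.zero_rpow_of_pos (by norm_num)] at h
  rw [ENNReal.tendsto_nhds_zero]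
  intro η hη
  have hη2 : 0 < η / 2 := ENNReal.half_pos hη.ne'
  obtain ⟨S, hS⟩ := (ENNReal.tendsto_nhds_zero.mp htail (η / 2) hη2).exists
  have hfin : Filter.Tendsto (fun T => ∑ i ∈ S, ‖u T i‖ₑ * ‖ψ i‖ₑ) Filter.atTop
      (nhds (∑ i ∈ S, 0 * ‖ψ i‖ₑ)) := by
    refine tendsto_finsetSum _ fun i _ => ?_
    exact ENNReal.Tendsto.mul_const (by simpa using (h0 i).enorm) (Or.inr (by simp))
  simp only [zero_mul, Finset.sum_const_zero] at hfin
  have hcs : ∀ T, ∑' i : { i // i ∉ S }, ‖u T i‖ₑ * ‖ψ i‖ₑ ≤ η / 2 := by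
    intro T
    have hhol := tsum_mul_le_Lp_mul_Lq Real.HolderConjugate.two_two
      (fun i : { i // i ∉ S } => ‖u T i‖ₑ) (fun i => ‖ψ i‖ₑ)
    have hle : ∑' i : { i // i ∉ S }, ‖u T i‖ₑ ^ 2 ≤ 1 :=
      (ENNReal.tsum_comp_le_tsum_of_injective Subtype.val_injective
        fun i => ‖u T i‖ₑ ^ 2).trans (hu T)
    simp only [ENNReal.rpow_two] at hhol
    calc _ ≤ _ := hhol
      _ ≤ 1 ^ (1 / 2 : ℝ) * (η / 2) := by gcongr
      _ = η / 2 := by simp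
  refine (ENNReal.tendsto_nhds_zero.mp hfin (η / 2) hη2).mono fun T hT => ?_
  calc ∑' i, ‖u T i‖ₑ * ‖ψ i‖ₑ
      = ∑ i ∈ S, ‖u T i‖ₑ * ‖ψ i‖ₑ + ∑' i : { i // i ∉ S }, ‖u T i‖ₑ * ‖ψ i‖ₑ :=
        (ENNReal.sum_add_tsum_compl S _).symm
    _ ≤ η / 2 + η / 2 := add_le_add hT (hcs T)
    _ = η := ENNReal.add_halves η

/-- The kernel of `exp (-it(μ - A)/2)`, where `A` is the adjacency operator of `ℤ³`. -/
def resolventFlow (μ : ℂ) (x : Fin 3 → ℤ) (t : ℝ) : ℂ :=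
  Complex.exp (-(Complex.I * μ / 2) * t) * latticeProp x t

/-- The time-truncated resolvent kernel. -/
def truncResolvent (μ : ℂ) (T : ℝ) (x : Fin 3 → ℤ) : ℂ := ∫ t in (0:ℝ)..T, resolventFlow μ x t

lemma enorm_resolventFlow_le {μ : ℂ} (hμ : μ.im ≤ 0) {t : ℝ} (ht : 0 ≤ t) (x : Fin 3 → ℤ) :
    ‖resolventFlow μ x t‖ₑ ≤ ‖latticeProp x t‖ₑ := by
  rw [resolventFlow, enorm_mul]
  refine mul_le_of_le_one_left' ?_
  rw [← ofReal_norm, ← ENNReal.ofReal_one, Complex.norm_exp]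
  refine ENNReal.ofReal_le_ofReal (Real.exp_le_one_iff.mpr ?_)
  simp
  nlinarith

lemma hasDerivAt_resolventFlow (μ : ℂ) (x : Fin 3 → ℤ) (t : ℝ) :
    HasDerivAt (resolventFlow μ x) (-(Complex.I / 2) *
      (μ * resolventFlow μ x t - adj (fun y => resolventFlow μ y t) x)) t := by
  have h1 : HasDerivAt (fun t : ℝ => Complex.exp (-(Complex.I * μ / 2) * t))
      (Complex.exp (-(Complex.I * μ / 2) * t) * (-(Complex.I * μ / 2) * 1)) t :=
    ((Complex.ofRealCLM.hasDerivAt (x := t)).const_mul _).cexp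
  refine (h1.mul (hasDerivAt_latticeProp x t)).congr_deriv ?_
  simp only [resolventFlow, adj, ← mul_add, ← Finset.mul_sum]
  ring

lemma continuous_resolventFlow (μ : ℂ) (x : Fin 3 → ℤ) : Continuous (resolventFlow μ x) :=
  continuous_iff_continuousAt.mpr fun t => (hasDerivAt_resolventFlow μ x t).continuousAt

lemma resolventFlow_zero (μ : ℂ) (x : Fin 3 → ℤ) :
    resolventFlow μ x 0 = if x = 0 then 1 else 0 := by
  simp [resolventFlow, latticeProp_zero]

lemma mul_truncResolvent_sub_adj (μ : ℂ) (T : ℝ) (x : Fin 3 → ℤ) :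
    μ * truncResolvent μ T x - adj (truncResolvent μ T) x =
      2 * Complex.I * (resolventFlow μ x T - if x = 0 then 1 else 0) := by
  have hint : ∀ y, IntervalIntegrable (resolventFlow μ y) volume 0 T := fun y =>
    (continuous_resolventFlow μ y).intervalIntegrable _ _
  have hadj : adj (truncResolvent μ T) x =
      ∫ t in (0:ℝ)..T, adj (fun y => resolventFlow μ y t) x := by
    simp only [adj, truncResolvent]
    rw [intervalIntegral.integral_finsetSum fun j _ => (hint _).add (hint _)]
    exact Finset.sum_congr rfl fun j _ => (intervalIntegral.integral_add (hint _) (hint _)).symm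
  have hcont : Continuous fun t => adj (fun y => resolventFlow μ y t) x :=
    continuous_finsetSum _ fun j _ =>
      (continuous_resolventFlow μ _).add (continuous_resolventFlow μ _)
  have hder := intervalIntegral.integral_eq_sub_of_hasDerivAt
    (fun t _ => hasDerivAt_resolventFlow μ x t) (a := 0) (b := T)
    ((((continuous_resolventFlow μ x).const_mul μ).sub hcont).const_mul
      _ |>.intervalIntegrable _ _)
  rw [intervalIntegral.integral_const_mul, intervalIntegral.integral_sub
    ((hint x).const_mul μ) (hcont.intervalIntegrable _ _), intervalIntegral.integral_const_mul,
    ← hadj, resolventFlow_zero, ← truncResolvent] at hder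
  rw [← hder]
  linear_combination (μ * truncResolvent μ T x - adj (truncResolvent μ T) x) *
    Complex.I_mul_I

lemma enorm_truncResolvent_le_lintegral {μ : ℂ} (hμ : μ.im ≤ 0) {T : ℝ} (hT : 0 ≤ T)
    (x : Fin 3 → ℤ) :
    ‖truncResolvent μ T x‖ₑ ≤ ∫⁻ t in Set.Ioc 0 T, ‖latticeProp x t‖ₑ := by
  rw [truncResolvent, intervalIntegral.integral_of_le hT]
  refine (enorm_integral_le_lintegral_enorm _).trans ?_
  exact setLIntegral_mono' measurableSet_Ioc fun t ht => enorm_resolventFlow_le hμ ht.1.le x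

lemma enorm_truncResolvent_le {μ : ℂ} (hμ : μ.im ≤ 0) {T : ℝ} (hT : 0 ≤ T) (x : Fin 3 → ℤ) :
    ‖truncResolvent μ T x‖ₑ ≤ greenBound x := by
  refine (enorm_truncResolvent_le_lintegral hμ hT x).trans ?_
  simp_rw [greenBound, ← enorm_latticeProp]
  exact lintegral_mono_set Set.Ioc_subset_Ioi_self

lemma tsum_enorm_latticeProp_sub_sq (x : Fin 3 → ℤ) (t : ℝ) :
    ∑' y, ‖latticeProp (x - y) t‖ₑ ^ 2 = 1 := by
  rw [← tsum_enorm_latticeProp_sq t]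
  exact (Equiv.subLeft x).tsum_eq fun y => ‖latticeProp y t‖ₑ ^ 2

lemma tsum_latticeProp_mul_le {ψ : (Fin 3 → ℤ) → ℂ} (x : Fin 3 → ℤ) (t : ℝ) :
    ∑' y, ‖latticeProp (x - y) t‖ₑ * ‖ψ y‖ₑ ≤ 1 + ∑' y, ‖ψ y‖ₑ ^ 2 := by
  calc _ ≤ ∑' y, (‖latticeProp (x - y) t‖ₑ ^ 2 + ‖ψ y‖ₑ ^ 2) :=
        ENNReal.tsum_le_tsum fun y => mul_le_sq_add_sq_ennreal _ _
    _ = _ := by rw [ENNReal.tsum_add, tsum_enorm_latticeProp_sub_sq]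

lemma summable_truncResolvent_mul {μ : ℂ} (hμ : μ.im ≤ 0) {T : ℝ} (hT : 0 ≤ T)
    {ψ : (Fin 3 → ℤ) → ℂ} (hψ : ∑' y, ‖ψ y‖ₑ ^ 2 ≠ ∞) (x : Fin 3 → ℤ) :
    Summable fun y => truncResolvent μ T (x - y) * ψ y := by
  apply summable_of_tsum_enorm_ne_top
  refine ne_top_of_le_ne_top
    (ENNReal.mul_ne_top (ENNReal.add_ne_top.mpr ⟨ENNReal.one_ne_top, hψ⟩)
      (ENNReal.ofReal_ne_top (r := T))) ?_
  calc ∑' y, ‖truncResolvent μ T (x - y) * ψ y‖ₑ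
      ≤ ∑' y, ∫⁻ t in Set.Ioc 0 T, ‖latticeProp (x - y) t‖ₑ * ‖ψ y‖ₑ := by
        refine ENNReal.tsum_le_tsum fun y => ?_
        rw [enorm_mul, lintegral_mul_const' _ _ enorm_ne_top]
        gcongr
        exact enorm_truncResolvent_le_lintegral hμ hT _
    _ = ∫⁻ t in Set.Ioc 0 T, ∑' y, ‖latticeProp (x - y) t‖ₑ * ‖ψ y‖ₑ := by
        rw [lintegral_tsum]
        exact fun y => ((continuous_latticeProp _).enorm.measurable.mul_const _).aemeasurable
    _ ≤ ∫⁻ t in Set.Ioc 0 T, (1 + ∑' y, ‖ψ y‖ₑ ^ 2) :=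
        lintegral_mono fun t => tsum_latticeProp_mul_le x t
    _ = _ := by simp

lemma enorm_le_tsum_greenBound_of_im_nonpos {μ : ℂ} (hμ : μ.im ≤ 0) {ψ f : (Fin 3 → ℤ) → ℂ}
    (hψ : ∑' y, ‖ψ y‖ₑ ^ 2 ≠ ∞) (hf : ∀ x, μ * ψ x - adj ψ x = f x) (x : Fin 3 → ℤ) :
    ‖ψ x‖ₑ ≤ ∑' y, greenBound (x - y) * ‖f y‖ₑ := by
  have key : ∀ T : ℝ, 0 ≤ T → ‖ψ x‖ₑ ≤
      (∑' y, ‖latticeProp (x - y) T‖ₑ * ‖ψ y‖ₑ) + ∑' y, greenBound (x - y) * ‖f y‖ₑ := by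
    intro T hT
    have hs := summable_truncResolvent_mul hμ hT hψ
    have h1 : HasSum (fun y => truncResolvent μ T (x - y) * f y)
        (μ * (∑' y, truncResolvent μ T (x - y) * ψ y) -
          adj (fun z => ∑' y, truncResolvent μ T (z - y) * ψ y) x) := by
      refine hasSum_of_forall_eq (fun y => ?_)
        (((hs x).hasSum.mul_left μ).sub (hasSum_mul_adj hs x))
      rw [← hf]; ring
    have h2 := ((hs x).hasSum.mul_left μ).sub (hasSum_adj_mul hs x)
    have hflow : Summable fun y => resolventFlow μ (x - y) T * ψ y := by
      apply summable_of_tsum_enorm_ne_top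
      refine ne_top_of_le_ne_top (ENNReal.add_ne_top.mpr ⟨ENNReal.one_ne_top, hψ⟩)
        (le_trans (ENNReal.tsum_le_tsum fun y => ?_) (tsum_latticeProp_mul_le x T))
      rw [enorm_mul]
      gcongr
      exact enorm_resolventFlow_le hμ hT _
    have h3 : HasSum (fun y => (if x - y = 0 then 1 else 0) * ψ y) (ψ x) := by
      convert hasSum_ite_eq x (ψ x) using 2 with y
      rcases eq_or_ne y x with rfl | hy
      · simp
      · simp [hy, sub_eq_zero, hy.symm]
    have h4 : HasSum (fun y => μ * (truncResolvent μ T (x - y) * ψ y) -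
        adj (truncResolvent μ T) (x - y) * ψ y)
        (2 * Complex.I * ((∑' y, resolventFlow μ (x - y) T * ψ y) - ψ x)) := by
      refine hasSum_of_forall_eq (fun y => ?_)
        ((hflow.hasSum.sub h3).mul_left (2 * Complex.I))
      linear_combination ψ y * mul_truncResolvent_sub_adj μ T (x - y)
    have h5 := (h4.unique h2).trans (h1.unique h1 ▸ h1.tsum_eq.symm)
    have h6 : ψ x = (∑' y, resolventFlow μ (x - y) T * ψ y) +
        Complex.I / 2 * ∑' y, truncResolvent μ T (x - y) * f y := by
      rw [← h5]
      linear_combination (-((∑' y, resolventFlow μ (x - y) T * ψ y) - ψ x)) * Complex.I_mul_I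
    rw [h6]
    refine (enorm_add_le _ _).trans (add_le_add ?_ ?_)
    · refine (enorm_tsum_le_tsum_enorm).trans (ENNReal.tsum_le_tsum fun y => ?_)
      rw [enorm_mul]
      gcongr
      exact enorm_resolventFlow_le hμ hT _
    · rw [enorm_mul]
      refine (mul_le_of_le_one_left' ?_).trans
        ((enorm_tsum_le_tsum_enorm).trans (ENNReal.tsum_le_tsum fun y => ?_))
      · rw [← ofReal_norm, ← ENNReal.ofReal_one]
        apply ENNReal.ofReal_le_ofReal
        norm_num
      · rw [enorm_mul]
        gcongr
        exact enorm_truncResolvent_le hμ hT _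
  have hlim := (tendsto_tsum_mul_zero (u := fun T y => latticeProp (x - y) T)
    (fun T => (tsum_enorm_latticeProp_sub_sq x T).le) hψ
    fun y => tendsto_latticeProp_atTop (x - y)).add_const (∑' y, greenBound (x - y) * ‖f y‖ₑ)
  rw [zero_add] at hlim
  refine ge_of_tendsto hlim ?_
  filter_upwards [Filter.eventually_ge_atTop 0] with T hT using key T hT

lemma enorm_le_tsum_greenBound {μ : ℂ} {ψ f : (Fin 3 → ℤ) → ℂ}
    (hψ : ∑' y, ‖ψ y‖ₑ ^ 2 ≠ ∞) (hf : ∀ x, μ * ψ x - adj ψ x = f x) (x : Fin 3 → ℤ) :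
    ‖ψ x‖ₑ ≤ ∑' y, greenBound (x - y) * ‖f y‖ₑ := by
  rcases le_total μ.im 0 with h | h
  · exact enorm_le_tsum_greenBound_of_im_nonpos h hψ hf x
  · have e : ∀ z : ℂ, ‖(starRingEnd ℂ) z‖ₑ = ‖z‖ₑ := fun z => by
      rw [← ofReal_norm, RCLike.norm_conj, ofReal_norm]
    have := enorm_le_tsum_greenBound_of_im_nonpos (μ := (starRingEnd ℂ) μ)
      (ψ := fun y => (starRingEnd ℂ) (ψ y)) (f := fun y => (starRingEnd ℂ) (f y))
      (by simpa using h) (by simpa only [e] using hψ)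
      (fun y => by rw [← hf]; simp [adj]) x
    simpa only [e] using this

end LatticeResolvent

section SquareRoot

/-- The operator `-A/7`, where `A` is the adjacency operator of `ℤ³`, so that
`1 - Δ = 7 (1 - A/7)`. -/
def negAdj (g : (Fin 3 → ℤ) → ℂ) (x : Fin 3 → ℤ) : ℂ := -(1 / 7) * adj g x

/-- The binomial coefficient `(1/2 choose m)`. -/
def halfChoose (m : ℕ) : ℂ := Ring.choose (1 / 2 : ℂ) m

/-- The norm bound of `negAdj`. -/
def adjRatio : ℝ≥0∞ := ENNReal.ofReal (6 / 7)

/-- The operator `√(1 + negAdj)`, defined by its binomial series. -/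
def binomialSqrt (g : (Fin 3 → ℤ) → ℂ) (x : Fin 3 → ℤ) : ℂ :=
  ∑' m, halfChoose m * negAdj^[m] g x

lemma adjRatio_eq : adjRatio = ‖(-(1 / 7) : ℂ)‖ₑ * 6 := by
  have h6 : (6 : ℝ≥0∞) = ENNReal.ofReal 6 := by simp
  rw [← ofReal_norm, h6, ← ENNReal.ofReal_mul (norm_nonneg _), adjRatio]
  congr 1
  norm_num

lemma enorm_adj_le (g : (Fin 3 → ℤ) → ℂ) (x : Fin 3 → ℤ) :
    ‖adj g x‖ₑ ≤ ∑ j, (‖g (x + Pi.single j 1)‖ₑ + ‖g (x - Pi.single j 1)‖ₑ) :=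
  (enorm_sum_le _ _).trans (Finset.sum_le_sum fun _ _ => enorm_add_le _ _)

lemma enorm_negAdj_le {g : (Fin 3 → ℤ) → ℂ} {C : ℝ≥0∞} (hg : ∀ x, ‖g x‖ₑ ≤ C)
    (x : Fin 3 → ℤ) : ‖negAdj g x‖ₑ ≤ adjRatio * C := by
  rw [negAdj, enorm_mul, adjRatio_eq, mul_assoc]
  gcongr
  calc ‖adj g x‖ₑ ≤ ∑ j : Fin 3, (C + C) :=
        (enorm_adj_le g x).trans (Finset.sum_le_sum fun _ _ => add_le_add (hg _) (hg _))
    _ = 6 * C := by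
        rw [Finset.sum_const, Finset.card_univ, Fintype.card_fin, nsmul_eq_mul, ← two_mul,
          ← mul_assoc]
        norm_num

lemma tsum_enorm_negAdj_le (g : (Fin 3 → ℤ) → ℂ) :
    ∑' x, ‖negAdj g x‖ₑ ≤ adjRatio * ∑' x, ‖g x‖ₑ := by
  simp_rw [negAdj, enorm_mul]
  rw [ENNReal.tsum_mul_left, adjRatio_eq, mul_assoc]
  gcongr
  have h1 : ∀ e : Fin 3 → ℤ, ∑' x, ‖g (x + e)‖ₑ = ∑' x, ‖g x‖ₑ := fun e =>
    (Equiv.addRight e).tsum_eq fun x => ‖g x‖ₑ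
  have h2 : ∀ e : Fin 3 → ℤ, ∑' x, ‖g (x - e)‖ₑ = ∑' x, ‖g x‖ₑ := fun e =>
    (Equiv.subRight e).tsum_eq fun x => ‖g x‖ₑ
  calc ∑' x, ‖adj g x‖ₑ
      ≤ ∑' x, ∑ j, (‖g (x + Pi.single j 1)‖ₑ + ‖g (x - Pi.single j 1)‖ₑ) :=
        ENNReal.tsum_le_tsum (enorm_adj_le g)
    _ = ∑ j : Fin 3, (∑' x, ‖g x‖ₑ + ∑' x, ‖g x‖ₑ) := by
        rw [Summable.tsum_finsetSum fun _ _ => ENNReal.summable]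
        exact Finset.sum_congr rfl fun j _ => by rw [ENNReal.tsum_add, h1, h2]
    _ = 6 * ∑' x, ‖g x‖ₑ := by
        rw [Finset.sum_const, Finset.card_univ, Fintype.card_fin, nsmul_eq_mul, ← two_mul,
          ← mul_assoc]
        norm_num

lemma enorm_iterate_negAdj_le {g : (Fin 3 → ℤ) → ℂ} {C : ℝ≥0∞} (hg : ∀ x, ‖g x‖ₑ ≤ C) (m : ℕ)
    (x : Fin 3 → ℤ) : ‖negAdj^[m] g x‖ₑ ≤ adjRatio ^ m * C := by
  induction m generalizing x with
  | zero => simpa using hg x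
  | succ m ih =>
    rw [Function.iterate_succ_apply', pow_succ', mul_assoc]
    exact enorm_negAdj_le ih x

lemma tsum_enorm_iterate_negAdj_le (g : (Fin 3 → ℤ) → ℂ) (m : ℕ) :
    ∑' x, ‖negAdj^[m] g x‖ₑ ≤ adjRatio ^ m * ∑' x, ‖g x‖ₑ := by
  induction m with
  | zero => simp
  | succ m ih =>
    rw [Function.iterate_succ_apply', pow_succ', mul_assoc]
    exact (tsum_enorm_negAdj_le _).trans (by gcongr)

lemma tsum_halfChoose_ne_top : ∑' m, ‖halfChoose m‖ₑ * adjRatio ^ m ≠ ∞ := by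
  have h := (binomialSeries ℂ (1 / 2 : ℂ)).summable_norm_mul_pow (r := 6 / 7)
    (lt_of_lt_of_le (by
      rw [← ENNReal.coe_one, ENNReal.coe_lt_coe]
      rw [div_lt_one (by norm_num)]; norm_num) binomialSeries_radius_ge_one)
  have h2 : ∀ m, ‖halfChoose m‖ₑ * adjRatio ^ m =
      ENNReal.ofReal (‖halfChoose m‖ * (6 / 7) ^ m) := fun m => by
    rw [adjRatio, ← ofReal_norm, ← ENNReal.ofReal_pow (by norm_num),
      ENNReal.ofReal_mul (norm_nonneg _)]
  simp_rw [h2]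
  refine Summable.tsum_ofReal_ne_top ?_
  convert h using 2 with m
  · simp [halfChoose, binomialSeries]

lemma sum_antidiagonal_halfChoose (N : ℕ) :
    ∑ p ∈ Finset.HasAntidiagonal.antidiagonal N, halfChoose p.1 * halfChoose p.2 = (Nat.choose 1 N : ℂ) := by
  simp only [halfChoose]
  rw [← Ring.add_choose_eq N (Commute.all _ _), add_halves,
    show (1 : ℂ) = ((1 : ℕ) : ℂ) by simp, Ring.choose_natCast]

lemma hasSum_halfChoose_mul_pow {s : ℝ} (hs : |s| < 1) :
    HasSum (fun m => halfChoose m * (s : ℂ) ^ m) (Real.sqrt (1 + s) : ℝ) := by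
  have h := (Complex.one_add_cpow_hasFPowerSeriesOnBall_zero (a := 1 / 2)).hasSum
    (y := (s : ℂ)) (by
      simp [← ofReal_norm, hs])
  have h1 : ((Real.sqrt (1 + s) : ℝ) : ℂ) = (1 + (0 + (s : ℂ))) ^ (1 / 2 : ℂ) := by
    rw [Real.sqrt_eq_rpow, Complex.ofReal_cpow (by linarith [neg_abs_le s])]
    simp
  rw [h1]
  refine hasSum_of_forall_eq (fun m => ?_) h
  rw [binomialSeries_apply]
  simp [halfChoose]

lemma summable_halfChoose_mul {q : ℕ → ℂ} {C : ℝ≥0∞} (hC : C ≠ ∞)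
    (hq : ∀ m, ‖q m‖ₑ ≤ adjRatio ^ m * C) : Summable fun m => halfChoose m * q m := by
  apply summable_of_tsum_enorm_ne_top
  refine ne_top_of_le_ne_top (ENNReal.mul_ne_top tsum_halfChoose_ne_top hC) ?_
  rw [← ENNReal.tsum_mul_right]
  refine ENNReal.tsum_le_tsum fun m => ?_
  rw [enorm_mul, mul_assoc]
  gcongr
  exact hq m

lemma negAdj_tsum {q : ℕ → (Fin 3 → ℤ) → ℂ} (hq : ∀ x, Summable fun m => q m x)
    (x : Fin 3 → ℤ) : negAdj (fun y => ∑' m, q m y) x = ∑' m, negAdj (q m) x := by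
  simp only [negAdj, adj]
  rw [tsum_mul_left, Summable.tsum_finsetSum fun j _ => (hq _).add (hq _)]
  congr 1
  exact Finset.sum_congr rfl fun j _ => ((hq _).tsum_add (hq _)).symm

lemma iterate_negAdj_binomialSqrt {g : (Fin 3 → ℤ) → ℂ} {C : ℝ≥0∞} (hC : C ≠ ∞)
    (hg : ∀ x, ‖g x‖ₑ ≤ C) (n : ℕ) (x : Fin 3 → ℤ) :
    negAdj^[n] (binomialSqrt g) x = ∑' m, halfChoose m * negAdj^[n + m] g x := by
  induction n generalizing x with
  | zero => simp [binomialSqrt]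
  | succ n ih =>
    rw [Function.iterate_succ_apply', funext ih, negAdj_tsum]
    · congr 1
      ext m
      rw [show n + 1 + m = n + m + 1 by ring, Function.iterate_succ_apply']
      simp only [negAdj, adj, Finset.mul_sum]
      exact Finset.sum_congr rfl fun j _ => by ring
    · intro y
      refine summable_halfChoose_mul (C := adjRatio ^ n * C)
        (ENNReal.mul_ne_top (by simp [adjRatio]) hC) fun m => ?_
      rw [← mul_assoc, ← pow_add, add_comm m n]
      exact enorm_iterate_negAdj_le hg _ _

lemma binomialSqrt_binomialSqrt {g : (Fin 3 → ℤ) → ℂ} {C : ℝ≥0∞} (hC : C ≠ ∞)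
    (hg : ∀ x, ‖g x‖ₑ ≤ C) (x : Fin 3 → ℤ) :
    binomialSqrt (binomialSqrt g) x = g x + negAdj g x := by
  have hsum : Summable fun p : ℕ × ℕ =>
      halfChoose p.1 * (halfChoose p.2 * negAdj^[p.1 + p.2] g x) := by
    apply summable_of_tsum_enorm_ne_top
    rw [ENNReal.tsum_prod']
    refine ne_top_of_le_ne_top (ENNReal.mul_ne_top (ENNReal.mul_ne_top tsum_halfChoose_ne_top
      tsum_halfChoose_ne_top) hC) ?_
    rw [mul_assoc, ← ENNReal.tsum_mul_right]
    refine ENNReal.tsum_le_tsum fun n => ?_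
    rw [← ENNReal.tsum_mul_right, ← ENNReal.tsum_mul_left]
    refine ENNReal.tsum_le_tsum fun m => ?_
    rw [enorm_mul, enorm_mul]
    calc _ ≤ ‖halfChoose n‖ₑ * (‖halfChoose m‖ₑ * (adjRatio ^ (n + m) * C)) := by
          gcongr
          exact enorm_iterate_negAdj_le hg _ _
      _ = _ := by rw [pow_add]; ring
  have h1 : binomialSqrt (binomialSqrt g) x =
      ∑' p : ℕ × ℕ, halfChoose p.1 * (halfChoose p.2 * negAdj^[p.1 + p.2] g x) := by
    rw [hsum.tsum_prod, binomialSqrt]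
    exact tsum_congr fun n => by rw [iterate_negAdj_binomialSqrt hC hg, ← tsum_mul_left]
  have h2 := (Finset.HasAntidiagonal.sigmaAntidiagonalEquivProd (A := ℕ)).tsum_eq
    fun p : ℕ × ℕ => halfChoose p.1 * (halfChoose p.2 * negAdj^[p.1 + p.2] g x)
  have h2s := (Finset.HasAntidiagonal.sigmaAntidiagonalEquivProd (A := ℕ)).summable_iff.mpr hsum
  rw [h1, ← h2]
  refine h2s.tsum_sigma.trans ?_
  have h3 : ∀ N, ∑' c : Finset.HasAntidiagonal.antidiagonal N,
      halfChoose c.1.1 * (halfChoose c.1.2 * negAdj^[c.1.1 + c.1.2] g x) =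
      (Nat.choose 1 N : ℂ) * negAdj^[N] g x := by
    intro N
    rw [Finset.tsum_subtype (Finset.HasAntidiagonal.antidiagonal N)
      fun c => halfChoose c.1 * (halfChoose c.2 * negAdj^[c.1 + c.2] g x),
      ← sum_antidiagonal_halfChoose, Finset.sum_mul]
    refine Finset.sum_congr rfl fun c hc => ?_
    rw [Finset.HasAntidiagonal.mem_antidiagonal.mp hc, mul_assoc]
  refine (tsum_congr h3 :).trans ?_
  rw [tsum_eq_sum (s := {0, 1})]
  · simp
  · intro N hN
    have : 1 < N := by
      simp at hN
      omega
    rw [Nat.choose_eq_zero_of_lt this]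
    simp

end SquareRoot

section MultiplierKernel

/-- The symbol of `negAdj`. -/
def adjSymbol (ξ : Fin 3 → ℝ) : ℝ := -(2 / 7) * ∑ j, Real.cos (ξ j)

lemma continuous_adjSymbol : Continuous adjSymbol := by
  unfold adjSymbol
  fun_prop

lemma abs_adjSymbol_le (ξ : Fin 3 → ℝ) : |adjSymbol ξ| ≤ 6 / 7 := by
  have h : |∑ j, Real.cos (ξ j)| ≤ 3 := by
    refine (Finset.abs_sum_le_sum_abs _ _).trans ?_
    refine (Finset.sum_le_sum fun j _ => Real.abs_cos_le_one (ξ j)).trans ?_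
    simp
  rw [adjSymbol, abs_mul, abs_neg, abs_of_pos (by norm_num : (0:ℝ) < 2 / 7)]
  linarith

lemma omegaKG_three_eq (ξ : Fin 3 → ℝ) :
    omegaKG 3 ξ = Real.sqrt 7 * Real.sqrt (1 + adjSymbol ξ) := by
  rw [omegaKG, ← Real.sqrt_mul (by norm_num)]
  congr 1
  simp only [adjSymbol, Fin.sum_univ_three]
  ring

lemma integral_exp_intCast_mul (n : ℤ) :
    ∫ θ in Set.Icc (0:ℝ) (2 * π), Complex.exp (Complex.I * ((n * θ : ℝ) : ℂ)) =
      if n = 0 then (2 * π : ℂ) else 0 := by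
  rw [integral_Icc_eq_integral_Ioc, ← intervalIntegral.integral_of_le (by positivity)]
  split_ifs with h
  · simp [h]
  · have hc : Complex.I * n ≠ 0 := mul_ne_zero Complex.I_ne_zero (by exact_mod_cast h)
    have := integral_exp_mul_complex (a := 0) (b := 2 * π) hc
    simp only [Complex.ofReal_mul, Complex.ofReal_intCast, ← mul_assoc] at this ⊢
    rw [this, show Complex.I * (n : ℂ) * ((2 : ℝ) : ℂ) * (π : ℂ) = n * (2 * π * Complex.I) by
      push_cast; ring, Complex.exp_int_mul_two_pi_mul_I]
    simp

lemma multKernel_one (x : Fin 3 → ℤ) :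
    multKernel 3 (fun _ => 1) x = if x = 0 then 1 else 0 := by
  have h1 : ∀ ξ : Fin 3 → ℝ,
      Complex.exp (Complex.I * ((∑ j : Fin 3, (x j : ℝ) * ξ j : ℝ) : ℂ)) * ((1 : ℝ) : ℂ) =
        ∏ j, Complex.exp (Complex.I * (((x j : ℝ) * ξ j : ℝ) : ℂ)) := fun ξ => by
    rw [← Complex.exp_sum, ← Finset.mul_sum, Complex.ofReal_sum, Complex.ofReal_one, mul_one]
  have h2 : cube 3 = Set.univ.pi fun _ => Set.Icc 0 (2 * π) := by
    rw [Set.pi_univ_Icc]; rfl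
  rw [multKernel]
  simp_rw [h1]
  rw [h2, volume_pi, Measure.restrict_pi_pi]
  rw [integral_fintype_prod_eq_prod (μ := fun _ => volume.restrict (Set.Icc 0 (2 * π)))
    (fun j (θ : ℝ) => Complex.exp (Complex.I * (((x j : ℝ) * θ : ℝ) : ℂ)))]
  simp_rw [integral_exp_intCast_mul]
  split_ifs with h
  · subst h
    have : (π : ℂ) ≠ 0 := by exact_mod_cast Real.pi_ne_zero
    simp [this]
  · obtain ⟨j, hj⟩ := Function.ne_iff.mp h
    rw [Finset.prod_eq_zero (Finset.mem_univ j) (if_neg (by simpa using hj)), mul_zero]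

lemma isCompact_cube (d : ℕ) : IsCompact (cube d) := isCompact_Icc

lemma multKernel_adjSymbol_mul {m : (Fin 3 → ℝ) → ℝ} (hm : Continuous m) (x : Fin 3 → ℤ) :
    multKernel 3 (fun ξ => adjSymbol ξ * m ξ) x = negAdj (multKernel 3 m) x := by
  have hint : ∀ y : Fin 3 → ℤ, Integrable (fun ξ : Fin 3 → ℝ =>
      Complex.exp (Complex.I * ((∑ j : Fin 3, (y j : ℝ) * ξ j : ℝ) : ℂ)) * ((m ξ : ℝ) : ℂ))
      (volume.restrict (cube 3)) := fun y =>
    (Continuous.continuousOn (by fun_prop)).integrableOn_compact (isCompact_cube 3)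
  simp only [negAdj, adj, multKernel, ← mul_add]
  rw [← Finset.mul_sum, mul_left_comm]
  congr 1
  have hsum : ∀ j : Fin 3, _ := fun j =>
    (integral_add (hint (x + Pi.single j 1)) (hint (x - Pi.single j 1))).symm
  have hsum_int : ∀ j : Fin 3, Integrable _ _ := fun j =>
    (hint (x + Pi.single j 1)).add (hint (x - Pi.single j 1))
  rw [Finset.sum_congr rfl fun j _ => hsum j]
  refine Eq.trans ?_ (congrArg _ (integral_finsetSum _ fun j _ => hsum_int j))
  rw [← integral_const_mul]
  congr 1
  ext ξ
  have hadd : ∀ (j : Fin 3), Complex.exp (Complex.I *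
      ((∑ i : Fin 3, ((x + (Pi.single j 1 : Fin 3 → ℤ)) i : ℝ) * ξ i : ℝ) : ℂ)) =
      Complex.exp (Complex.I * ((∑ i : Fin 3, (x i : ℝ) * ξ i : ℝ) : ℂ)) *
        Complex.exp (ξ j * Complex.I) := fun j => by
    rw [← Complex.exp_add]
    congr 1
    simp [Finset.sum_add_distrib, Pi.single_apply, mul_add, mul_comm]
  have hsub : ∀ (j : Fin 3), Complex.exp (Complex.I *
      ((∑ i : Fin 3, ((x - (Pi.single j 1 : Fin 3 → ℤ)) i : ℝ) * ξ i : ℝ) : ℂ)) =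
      Complex.exp (Complex.I * ((∑ i : Fin 3, (x i : ℝ) * ξ i : ℝ) : ℂ)) *
        Complex.exp (-ξ j * Complex.I) := fun j => by
    rw [← Complex.exp_add]
    congr 1
    simp [sub_mul, Finset.sum_sub_distrib, Pi.single_apply, mul_comm Complex.I]
    ring
  have hcos : ∀ j : Fin 3, Complex.exp (ξ j * Complex.I) + Complex.exp (-ξ j * Complex.I) =
      2 * Complex.cos (ξ j) := fun j => (Complex.two_cos _).symm
  have hterm : ∀ j : Fin 3,
      Complex.exp (Complex.I *
          ((∑ i : Fin 3, ((x + (Pi.single j 1 : Fin 3 → ℤ)) i : ℝ) * ξ i : ℝ) : ℂ)) * (m ξ : ℂ) +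
        Complex.exp (Complex.I *
          ((∑ i : Fin 3, ((x - (Pi.single j 1 : Fin 3 → ℤ)) i : ℝ) * ξ i : ℝ) : ℂ)) * (m ξ : ℂ) =
      Complex.exp (Complex.I * ((∑ i : Fin 3, (x i : ℝ) * ξ i : ℝ) : ℂ)) *
        (2 * Complex.cos (ξ j)) * (m ξ : ℂ) := fun j => by
    rw [hadd, hsub, ← add_mul, ← mul_add, hcos]
  refine Eq.trans ?_ (congrArg (-(1 / 7 : ℂ) * ·) (Finset.sum_congr rfl fun j _ => (hterm j).symm))
  rw [← Finset.sum_mul, ← Finset.mul_sum, ← Finset.mul_sum, adjSymbol]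
  push_cast
  ring

lemma multKernel_adjSymbol_pow (m : ℕ) :
    multKernel 3 (fun ξ => adjSymbol ξ ^ m) = negAdj^[m] fun x => if x = 0 then 1 else 0 := by
  induction m with
  | zero => ext x; simpa using multKernel_one x
  | succ m ih =>
    rw [Function.iterate_succ_apply', ← ih]
    ext x
    simp_rw [pow_succ']
    exact multKernel_adjSymbol_mul (continuous_adjSymbol.pow m) x

lemma multKernel_omegaKG (x : Fin 3 → ℤ) :
    multKernel 3 (omegaKG 3) x =
      (Real.sqrt 7 : ℝ) * binomialSqrt (fun x => if x = 0 then 1 else 0) x := by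
  have hb : Summable fun m => ‖halfChoose m‖ * (6 / 7 : ℝ) ^ m := by
    have := ENNReal.summable_toReal tsum_halfChoose_ne_top
    refine this.congr fun m => ?_
    rw [ENNReal.toReal_mul, ENNReal.toReal_pow, adjRatio, toReal_enorm,
      ENNReal.toReal_ofReal (by norm_num)]
  have hfin : volume (cube 3) ≠ ∞ := (isCompact_cube 3).measure_lt_top.ne
  have : Fact (volume (cube 3) < ∞) := ⟨hfin.lt_top⟩
  have hbound : ∀ (m : ℕ) (ξ : Fin 3 → ℝ),
      ‖Complex.exp (Complex.I * ((∑ j : Fin 3, (x j : ℝ) * ξ j : ℝ) : ℂ)) *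
        (halfChoose m * (adjSymbol ξ : ℂ) ^ m)‖ ≤ ‖halfChoose m‖ * (6 / 7 : ℝ) ^ m := by
    intro m ξ
    rw [norm_mul, norm_mul, mul_comm Complex.I, Complex.norm_exp_ofReal_mul_I, one_mul, norm_pow,
      Complex.norm_real, Real.norm_eq_abs]
    gcongr
    exact abs_adjSymbol_le ξ
  have hcont := continuous_adjSymbol
  have h := hasSum_integral_of_dominated_convergence (μ := volume.restrict (cube 3))
    (F := fun (m : ℕ) (ξ : Fin 3 → ℝ) =>
      Complex.exp (Complex.I * ((∑ j : Fin 3, (x j : ℝ) * ξ j : ℝ) : ℂ)) *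
        (halfChoose m * (adjSymbol ξ : ℂ) ^ m))
    (f := fun ξ => Complex.exp (Complex.I * ((∑ j : Fin 3, (x j : ℝ) * ξ j : ℝ) : ℂ)) *
      ((Real.sqrt (1 + adjSymbol ξ) : ℝ) : ℂ))
    (fun m _ => ‖halfChoose m‖ * (6 / 7 : ℝ) ^ m)
    (fun m => (Continuous.aestronglyMeasurable (by fun_prop)))
    (fun m => Filter.Eventually.of_forall (hbound m))
    (Filter.Eventually.of_forall fun _ => hb) (integrable_const _)
    (Filter.Eventually.of_forall fun ξ => (hasSum_halfChoose_mul_pow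
      ((abs_adjSymbol_le ξ).trans_lt (by norm_num))).mul_left _)
  have h1 : multKernel 3 (omegaKG 3) x = (((2 * π) ^ 3)⁻¹ : ℝ) * ((Real.sqrt 7 : ℝ) *
      ∫ ξ in cube 3, Complex.exp (Complex.I * ((∑ j : Fin 3, (x j : ℝ) * ξ j : ℝ) : ℂ)) *
        ((Real.sqrt (1 + adjSymbol ξ) : ℝ) : ℂ)) := by
    rw [multKernel, ← integral_const_mul ((Real.sqrt 7 : ℝ) : ℂ)]
    congr 1
    refine integral_congr_ae (Filter.Eventually.of_forall fun ξ => ?_)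
    dsimp only
    rw [omegaKG_three_eq]
    push_cast
    ring
  rw [h1, ← h.tsum_eq, mul_left_comm, ← tsum_mul_left, binomialSqrt]
  congr 1
  refine tsum_congr fun m => ?_
  rw [← multKernel_adjSymbol_pow, multKernel, mul_left_comm, ← integral_const_mul (halfChoose m)]
  congr 1
  refine integral_congr_ae (Filter.Eventually.of_forall fun ξ => ?_)
  dsimp only
  push_cast
  ring

lemma tsum_enorm_delta : ∑' x : Fin 3 → ℤ, ‖(if x = 0 then 1 else 0 : ℂ)‖ₑ = 1 := by
  rw [tsum_eq_single 0 fun x hx => by simp [hx]]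
  simp

lemma tsum_enorm_multKernel_ne_top : ∑' x, ‖multKernel 3 (omegaKG 3) x‖ₑ ≠ ∞ := by
  simp_rw [multKernel_omegaKG, enorm_mul]
  rw [ENNReal.tsum_mul_left]
  refine ENNReal.mul_ne_top enorm_ne_top (ne_top_of_le_ne_top tsum_halfChoose_ne_top ?_)
  calc ∑' x, ‖binomialSqrt (fun x => if x = 0 then 1 else 0) x‖ₑ
      ≤ ∑' x, ∑' m, ‖halfChoose m * negAdj^[m] (fun x => if x = 0 then 1 else 0) x‖ₑ :=
        ENNReal.tsum_le_tsum fun x => enorm_tsum_le_tsum_enorm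
    _ = ∑' m, ‖halfChoose m‖ₑ * ∑' x, ‖negAdj^[m] (fun x => if x = 0 then 1 else 0) x‖ₑ := by
        rw [ENNReal.tsum_comm]
        simp_rw [enorm_mul, ENNReal.tsum_mul_left]
    _ ≤ _ := by
        refine ENNReal.tsum_le_tsum fun m => ?_
        gcongr
        refine (tsum_enorm_iterate_negAdj_le _ m).trans ?_
        rw [tsum_enorm_delta, mul_one]

lemma tsum_enorm_sub_left (k : (Fin 3 → ℤ) → ℂ) (x : Fin 3 → ℤ) :
    ∑' y, ‖k (x - y)‖ₑ = ∑' y, ‖k y‖ₑ :=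
  (Equiv.subLeft x).tsum_eq fun y => ‖k y‖ₑ

lemma tsum_enorm_convolution_le {k g : (Fin 3 → ℤ) → ℂ} {C : ℝ≥0∞} (hg : ∀ x, ‖g x‖ₑ ≤ C)
    (x : Fin 3 → ℤ) : ∑' y, ‖k (x - y) * g y‖ₑ ≤ (∑' y, ‖k y‖ₑ) * C := by
  rw [← tsum_enorm_sub_left k x, ← ENNReal.tsum_mul_right]
  refine ENNReal.tsum_le_tsum fun y => ?_
  rw [enorm_mul]
  gcongr
  exact hg y

lemma summable_convolution {k g : (Fin 3 → ℤ) → ℂ} {C : ℝ≥0∞} (hk : ∑' y, ‖k y‖ₑ ≠ ∞)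
    (hC : C ≠ ∞) (hg : ∀ x, ‖g x‖ₑ ≤ C) (x : Fin 3 → ℤ) :
    Summable fun y => k (x - y) * g y :=
  summable_of_tsum_enorm_ne_top
    (ne_top_of_le_ne_top (ENNReal.mul_ne_top hk hC) (tsum_enorm_convolution_le hg x))

lemma tsum_enorm_iterate_negAdj_delta_le (m : ℕ) :
    ∑' x, ‖negAdj^[m] (fun x => if x = 0 then 1 else 0) x‖ₑ ≤ adjRatio ^ m := by
  refine (tsum_enorm_iterate_negAdj_le _ m).trans ?_
  rw [tsum_enorm_delta, mul_one]

lemma tsum_iterate_negAdj_delta_mul {g : (Fin 3 → ℤ) → ℂ} {C : ℝ≥0∞} (hC : C ≠ ∞)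
    (hg : ∀ x, ‖g x‖ₑ ≤ C) (m : ℕ) (x : Fin 3 → ℤ) :
    ∑' y, negAdj^[m] (fun x => if x = 0 then 1 else 0) (x - y) * g y = negAdj^[m] g x := by
  induction m generalizing x with
  | zero =>
    rw [tsum_eq_single x fun y hy => by simp [sub_eq_zero, hy.symm]]
    simp
  | succ m ih =>
    have hs : ∀ x, Summable fun y =>
        negAdj^[m] (fun x => if x = 0 then 1 else 0) (x - y) * g y :=
      summable_convolution (ne_top_of_le_ne_top (by simp [adjRatio])
        (tsum_enorm_iterate_negAdj_delta_le m)) hC hg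
    simp_rw [Function.iterate_succ_apply', negAdj, mul_assoc]
    rw [tsum_mul_left, (hasSum_adj_mul hs x).tsum_eq, funext ih]

lemma sqrtOneSubLap_eq {g : (Fin 3 → ℤ) → ℂ} {C : ℝ≥0∞} (hC : C ≠ ∞)
    (hg : ∀ x, ‖g x‖ₑ ≤ C) (x : Fin 3 → ℤ) :
    sqrtOneSubLap 3 g x = (Real.sqrt 7 : ℝ) * binomialSqrt g x := by
  simp_rw [sqrtOneSubLap, multKernel_omegaKG, binomialSqrt, mul_assoc]
  rw [tsum_mul_left]
  congr 1
  simp_rw [← tsum_mul_right]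
  rw [Summable.tsum_comm]
  · simp_rw [mul_assoc, tsum_mul_left, tsum_iterate_negAdj_delta_mul hC hg]
  · apply summable_of_tsum_enorm_ne_top
    refine ne_top_of_le_ne_top (ENNReal.mul_ne_top tsum_halfChoose_ne_top hC) ?_
    rw [ENNReal.tsum_prod', ← ENNReal.tsum_mul_right]
    refine ENNReal.tsum_le_tsum fun m => ?_
    simp_rw [Function.uncurry_apply_pair, mul_assoc, enorm_mul (halfChoose m)]
    rw [ENNReal.tsum_mul_left]
    gcongr
    exact (tsum_enorm_convolution_le hg x).trans
      (by gcongr; exact tsum_enorm_iterate_negAdj_delta_le m)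

lemma enorm_sqrtOneSubLap_le {g : (Fin 3 → ℤ) → ℂ} {C : ℝ≥0∞} (hg : ∀ x, ‖g x‖ₑ ≤ C)
    (x : Fin 3 → ℤ) :
    ‖sqrtOneSubLap 3 g x‖ₑ ≤ (∑' y, ‖multKernel 3 (omegaKG 3) y‖ₑ) * C :=
  (enorm_tsum_le_tsum_enorm).trans (tsum_enorm_convolution_le hg x)

lemma tsum_enorm_sqrtOneSubLap_le (g : (Fin 3 → ℤ) → ℂ) :
    ∑' x, ‖sqrtOneSubLap 3 g x‖ₑ ≤
      (∑' y, ‖multKernel 3 (omegaKG 3) y‖ₑ) * ∑' x, ‖g x‖ₑ := by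
  calc ∑' x, ‖sqrtOneSubLap 3 g x‖ₑ
      ≤ ∑' x, ∑' y, ‖multKernel 3 (omegaKG 3) (x - y) * g y‖ₑ :=
        ENNReal.tsum_le_tsum fun x => enorm_tsum_le_tsum_enorm
    _ = ∑' y, ∑' x, ‖multKernel 3 (omegaKG 3) (x - y)‖ₑ * ‖g y‖ₑ := by
        rw [ENNReal.tsum_comm]
        simp_rw [enorm_mul]
    _ = _ := by
        rw [← ENNReal.tsum_mul_left]
        refine tsum_congr fun y => ?_
        rw [ENNReal.tsum_mul_right]
        congr 1
        exact (Equiv.subRight y).tsum_eq fun x => ‖multKernel 3 (omegaKG 3) x‖ₑ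

lemma iterate_negAdj_const_mul (c : ℂ) (g : (Fin 3 → ℤ) → ℂ) (m : ℕ) (x : Fin 3 → ℤ) :
    negAdj^[m] (fun y => c * g y) x = c * negAdj^[m] g x := by
  induction m generalizing x with
  | zero => rfl
  | succ m ih =>
    rw [Function.iterate_succ_apply', Function.iterate_succ_apply', funext ih]
    simp only [negAdj, adj, ← mul_add, ← Finset.mul_sum]
    ring

lemma binomialSqrt_const_mul (c : ℂ) (g : (Fin 3 → ℤ) → ℂ) (x : Fin 3 → ℤ) :
    binomialSqrt (fun y => c * g y) x = c * binomialSqrt g x := by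
  simp_rw [binomialSqrt, iterate_negAdj_const_mul, mul_left_comm _ c, tsum_mul_left]

lemma sqrtOneSubLap_sqrtOneSubLap {g : (Fin 3 → ℤ) → ℂ} {C : ℝ≥0∞} (hC : C ≠ ∞)
    (hg : ∀ x, ‖g x‖ₑ ≤ C) (x : Fin 3 → ℤ) :
    sqrtOneSubLap 3 (sqrtOneSubLap 3 g) x = 7 * g x - adj g x := by
  have h7 : ((Real.sqrt 7 : ℝ) : ℂ) * (Real.sqrt 7 : ℝ) = 7 := by
    rw [← Complex.ofReal_mul, Real.mul_self_sqrt (by norm_num)]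
    norm_num
  have hlin : binomialSqrt (sqrtOneSubLap 3 g) x =
      (Real.sqrt 7 : ℝ) * binomialSqrt (binomialSqrt g) x := by
    rw [← binomialSqrt_const_mul, funext (sqrtOneSubLap_eq hC hg)]
  rw [sqrtOneSubLap_eq (ENNReal.mul_ne_top tsum_enorm_multKernel_ne_top hC)
    (enorm_sqrtOneSubLap_le hg), hlin, binomialSqrt_binomialSqrt hC hg, negAdj]
  linear_combination (g x - 1 / 7 * adj g x) * h7

end MultiplierKernel

section Eigenvalue

lemma tsum_enorm_rpow_le {V : (Fin 3 → ℤ) → ℂ} {e : ℝ≥0∞}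
    (hV : eLpNorm V (7 / 6) Measure.count ≤ e) :
    (∑' x, ‖V x‖ₑ ^ (7 / 6 : ℝ)) ^ (1 / (7 / 6 : ℝ)) ≤ e := by
  have h0 : (7 / 6 : ℝ≥0∞) ≠ 0 := by simp
  have htop : (7 / 6 : ℝ≥0∞) ≠ ∞ := ENNReal.div_ne_top (by simp) (by simp)
  have hr : (7 / 6 : ℝ≥0∞).toReal = 7 / 6 := by simp
  rwa [eLpNorm_eq_lintegral_rpow_enorm_toReal h0 htop, lintegral_count, hr] at hV

lemma tsum_enorm_sq_le_one {V : (Fin 3 → ℤ) → ℂ}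
    (hV : (∑' x, ‖V x‖ₑ ^ (7 / 6 : ℝ)) ^ (1 / (7 / 6 : ℝ)) ≤ 1) :
    (∀ x, ‖V x‖ₑ ≤ 1) ∧ ∑' x, ‖V x‖ₑ ^ 2 ≤ 1 := by
  have hsum : ∑' x, ‖V x‖ₑ ^ (7 / 6 : ℝ) ≤ 1 := by
    by_contra! h
    exact absurd hV (not_le.2 (ENNReal.one_lt_rpow h (by norm_num)))
  have hpt : ∀ x, ‖V x‖ₑ ≤ 1 := fun x => by
    by_contra! h
    exact absurd ((ENNReal.le_tsum x).trans hsum) (not_le.2 (ENNReal.one_lt_rpow h (by norm_num)))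
  refine ⟨hpt, (ENNReal.tsum_le_tsum fun x => ?_).trans hsum⟩
  rw [← ENNReal.rpow_two]
  exact ENNReal.rpow_le_rpow_of_exponent_ge (hpt x) (by norm_num)

lemma tsum_enorm_sq_ne_top_of_memℓp {ψ : (Fin 3 → ℤ) → ℂ} (hψ : Memℓp ψ 2) :
    ∑' x, ‖ψ x‖ₑ ^ 2 ≠ ∞ := by
  have h := (memℓp_gen_iff (by simp)).1 hψ
  have := h.tsum_ofReal_ne_top
  convert this using 3 with x
  rw [← ofReal_norm, ← ENNReal.ofReal_pow (norm_nonneg _)]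
  simp

lemma sqrtOneSubLap_const_mul_sub {g h : (Fin 3 → ℤ) → ℂ} {C D : ℝ≥0∞} (hC : C ≠ ∞) (hD : D ≠ ∞)
    (hg : ∀ x, ‖g x‖ₑ ≤ C) (hh : ∀ x, ‖h x‖ₑ ≤ D) (c : ℂ) (x : Fin 3 → ℤ) :
    sqrtOneSubLap 3 (fun y => c * g y - h y) x =
      c * sqrtOneSubLap 3 g x - sqrtOneSubLap 3 h x := by
  have hsg := summable_convolution tsum_enorm_multKernel_ne_top hC hg x
  have hsh := summable_convolution tsum_enorm_multKernel_ne_top hD hh x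
  simp only [sqrtOneSubLap]
  rw [← tsum_mul_left, ← (hsg.mul_left c).tsum_sub hsh]
  exact tsum_congr fun y => by ring

lemma tsum_enorm_mul_le {V ψ f : (Fin 3 → ℤ) → ℂ}
    (h : ∀ x, ‖ψ x‖ₑ ≤ ∑' y, greenBound (x - y) * ‖f y‖ₑ) :
    ∑' x, ‖V x * ψ x‖ₑ ≤ (∑' x, ‖V x‖ₑ ^ (7 / 6 : ℝ)) ^ (1 / (7 / 6 : ℝ)) *
      (∑' x, greenBound x ^ (7 : ℝ)) ^ (1 / (7 : ℝ)) * ∑' y, ‖f y‖ₑ := by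
  have hpq : (7 / 6 : ℝ).HolderConjugate 7 := by
    rw [Real.holderConjugate_iff]; norm_num
  calc ∑' x, ‖V x * ψ x‖ₑ
      ≤ ∑' x, ∑' y, ‖V x‖ₑ * greenBound (x - y) * ‖f y‖ₑ := ENNReal.tsum_le_tsum fun x => by
        simp_rw [enorm_mul, mul_assoc, ENNReal.tsum_mul_left]
        gcongr
        exact h x
    _ = ∑' y, (∑' x, ‖V x‖ₑ * greenBound (x - y)) * ‖f y‖ₑ := by
        rw [ENNReal.tsum_comm]
        simp_rw [ENNReal.tsum_mul_right]
    _ ≤ ∑' y, ((∑' x, ‖V x‖ₑ ^ (7 / 6 : ℝ)) ^ (1 / (7 / 6 : ℝ)) *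
          (∑' x, greenBound x ^ (7 : ℝ)) ^ (1 / (7 : ℝ))) * ‖f y‖ₑ :=
        ENNReal.tsum_le_tsum fun y => by
          gcongr
          refine (tsum_mul_le_Lp_mul_Lq hpq _ _).trans_eq ?_
          rw [← (Equiv.subRight y).tsum_eq fun z => greenBound z ^ (7 : ℝ)]
          rfl
    _ = _ := ENNReal.tsum_mul_left

/-- The eigenvalue of a bounded eigenfunction is controlled by the `ℓ¹` norm of the kernel. -/
lemma enorm_eigenvalue_le {V ψ : (Fin 3 → ℤ) → ℂ} {lam : ℂ} {C : ℝ≥0∞} (hC : C ≠ ∞)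
    (hψC : ∀ x, ‖ψ x‖ₑ ≤ C) (hV : ∀ x, ‖V x‖ₑ ≤ 1) (hψ : ψ ≠ 0)
    (heq : ∀ x, sqrtOneSubLap 3 ψ x + V x * ψ x = lam * ψ x) :
    ‖lam‖ₑ ≤ ∑' x, ‖multKernel 3 (omegaKG 3) x‖ₑ + 1 := by
  set K := ∑' x, ‖multKernel 3 (omegaKG 3) x‖ₑ
  set S := ⨆ x, ‖ψ x‖ₑ with hS
  have hle : ∀ x, ‖ψ x‖ₑ ≤ S := fun x => le_iSup (fun x => ‖ψ x‖ₑ) x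
  have hStop : S ≠ ∞ := ne_top_of_le_ne_top hC (iSup_le hψC)
  have hS0 : S ≠ 0 := fun h => hψ <| funext fun x => by
    simpa [h] using hle x
  have : ‖lam‖ₑ * S ≤ (K + 1) * S := by
    rw [hS, ENNReal.mul_iSup, ← hS]
    refine iSup_le fun x => ?_
    rw [← enorm_mul, ← heq x, add_mul]
    refine (enorm_add_le _ _).trans (add_le_add (enorm_sqrtOneSubLap_le hle x) ?_)
    rw [enorm_mul]
    exact mul_le_mul' (hV x) (hle x)
  rwa [ENNReal.mul_le_mul_iff_left hS0 hStop] at this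

lemma eq_zero_of_eigenvalue_equation {V ψ : (Fin 3 → ℤ) → ℂ} {lam : ℂ} {e : ℝ≥0∞}
    (hV : (∑' x, ‖V x‖ₑ ^ (7 / 6 : ℝ)) ^ (1 / (7 / 6 : ℝ)) ≤ e) (he1 : e ≤ 1)
    (he : e * ((∑' x, greenBound x ^ (7 : ℝ)) ^ (1 / (7 : ℝ)) *
      (2 * ∑' x, ‖multKernel 3 (omegaKG 3) x‖ₑ + 1)) < 1)
    (hψ : ∑' x, ‖ψ x‖ₑ ^ 2 ≠ ∞)
    (heq : ∀ x, sqrtOneSubLap 3 ψ x + V x * ψ x = lam * ψ x) : ψ = 0 := by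
  by_contra hne
  obtain ⟨hV1, hV2⟩ := tsum_enorm_sq_le_one (hV.trans he1)
  set K := ∑' x, ‖multKernel 3 (omegaKG 3) x‖ₑ with hK
  set G := (∑' x, greenBound x ^ (7 : ℝ)) ^ (1 / (7 : ℝ))
  set a := ∑' x, ‖V x * ψ x‖ₑ with ha
  have hatop : a ≠ ∞ := by
    refine ne_top_of_le_ne_top
      (ENNReal.add_ne_top.2 ⟨ne_top_of_le_ne_top ENNReal.one_ne_top hV2, hψ⟩) ?_
    rw [← ENNReal.tsum_add]
    exact ENNReal.tsum_le_tsum fun x => by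
      rw [enorm_mul]
      exact mul_le_sq_add_sq_ennreal _ _
  obtain ⟨C, hC, hψC⟩ : ∃ C : ℝ≥0∞, C ≠ ∞ ∧ ∀ x, ‖ψ x‖ₑ ≤ C := by
    refine ⟨1 + ∑' x, ‖ψ x‖ₑ ^ 2, by simp [hψ], fun x => ?_⟩
    rcases le_total ‖ψ x‖ₑ 1 with h | h
    · simpa using h.trans le_self_add
    · refine le_trans ?_ (le_add_self.trans' (ENNReal.le_tsum x))
      exact le_self_pow₀ h two_ne_zero
  have hVψC : ∀ x, ‖V x * ψ x‖ₑ ≤ C := fun x => by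
    rw [enorm_mul]
    exact (mul_le_mul' (hV1 x) (hψC x)).trans_eq (one_mul C)
  have hlam := enorm_eigenvalue_le hC hψC hV1 hne heq
  have hsqrt : sqrtOneSubLap 3 ψ = fun x => lam * ψ x - V x * ψ x :=
    funext fun x => eq_sub_of_add_eq (heq x)
  set f : (Fin 3 → ℤ) → ℂ := fun x =>
    -(lam * (V x * ψ x)) - sqrtOneSubLap 3 (fun y => V y * ψ y) x with hf
  have hres : ∀ x, (7 - lam ^ 2) * ψ x - adj ψ x = f x := fun x => by
    have h := sqrtOneSubLap_sqrtOneSubLap hC hψC x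
    rw [hsqrt, sqrtOneSubLap_const_mul_sub hC hC hψC hVψC, hsqrt] at h
    simp only [hf]
    linear_combination -h
  have hψf := enorm_le_tsum_greenBound hψ hres
  have hfle : ∑' x, ‖f x‖ₑ ≤ (2 * K + 1) * a := by
    calc ∑' x, ‖f x‖ₑ ≤ ∑' x, (‖lam‖ₑ * ‖V x * ψ x‖ₑ +
          ‖sqrtOneSubLap 3 (fun y => V y * ψ y) x‖ₑ) := ENNReal.tsum_le_tsum fun x => by
          refine (enorm_sub_le).trans_eq ?_
          rw [enorm_neg, enorm_mul lam]
      _ ≤ (K + 1) * a + K * a := by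
          rw [ENNReal.tsum_add, ENNReal.tsum_mul_left]
          exact add_le_add (mul_le_mul' hlam le_rfl) (tsum_enorm_sqrtOneSubLap_le _)
      _ = (2 * K + 1) * a := by ring
  have hale : a ≤ e * (G * (2 * K + 1)) * a := by
    calc a ≤ _ * G * ∑' y, ‖f y‖ₑ := tsum_enorm_mul_le hψf
      _ ≤ e * G * ((2 * K + 1) * a) := by gcongr
      _ = _ := by ring
  have ha0 : a = 0 := by
    by_contra h0
    refine absurd hale (not_le.2 ?_)
    calc e * (G * (2 * K + 1)) * a < 1 * a := ENNReal.mul_lt_mul_left h0 hatop he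
      _ = a := one_mul a
  have hf0 : ∀ y, ‖f y‖ₑ = 0 := by
    rw [ha0, mul_zero, nonpos_iff_eq_zero, ENNReal.tsum_eq_zero] at hfle
    exact hfle
  exact hne <| funext fun x => by simpa [hf0] using hψf x

end Eigenvalue

/-- Absence of eigenvalues for the stationary discrete Klein--Gordon equation on `ℤ³`
with a potential small in `ℓ^{7/6}`: if `‖V‖_{ℓ^{7/6}} ≤ ε` then
`√(1−Δ)ψ + Vψ = λψ` has no nontrivial solution `ψ ∈ ℓ²(ℤ³)`. -/
theorem no_eigenvalues_d3 :
    ∃ ε > (0:ℝ), ∀ V : (Fin 3 → ℤ) → ℂ,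
      eLpNorm V (7/6) Measure.count ≤ ENNReal.ofReal ε →
      ∀ (lam : ℂ) (ψ : (Fin 3 → ℤ) → ℂ), Memℓp ψ 2 →
        (∀ x, sqrtOneSubLap 3 ψ x + V x * ψ x = lam * ψ x) → ψ = 0 := by
  set B := (∑' x, greenBound x ^ (7 : ℝ)) ^ (1 / (7 : ℝ)) *
    (2 * ∑' x, ‖multKernel 3 (omegaKG 3) x‖ₑ + 1) with hB
  have hBtop : B ≠ ∞ := ENNReal.mul_ne_top
    (ENNReal.rpow_ne_top_of_nonneg (by norm_num) tsum_greenBound_rpow_lt_top.ne)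
    (ENNReal.add_ne_top.2 ⟨ENNReal.mul_ne_top (by simp) tsum_enorm_multKernel_ne_top, by simp⟩)
  have hpos : 0 < B.toReal + 1 := by positivity
  refine ⟨1 / (B.toReal + 1), by positivity, fun V hV lam ψ hψ heq => ?_⟩
  refine eq_zero_of_eigenvalue_equation (tsum_enorm_rpow_le hV) ?_ ?_
    (tsum_enorm_sq_ne_top_of_memℓp hψ) heq
  · rw [ENNReal.ofReal_le_one, div_le_one hpos]
    linarith [ENNReal.toReal_nonneg (a := B)]
  · rw [← hB, ← ENNReal.ofReal_toReal hBtop, ← ENNReal.ofReal_mul (by positivity),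
      ENNReal.ofReal_lt_one, one_div_mul_eq_div, ENNReal.toReal_ofReal ENNReal.toReal_nonneg,
      div_lt_one hpos]
    linarith
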